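/- arXiv:2107.12175 — 9 statements merged into one kernel-verified Lean document; each statement's English description precedes it below -/
import Mathlib

section
/- For every positive integer k and every σ ∈ ℝ, the shifted cosine q(t) := c_k·cos(2πk(t+σ)) with amplitude c_k := 2^(−1/6)·(πk)^(−1/3) is a critical point of the regularized free-fall functional ℬ; that is, for every smooth 1-periodic ξ : ℝ → ℝ one has dℬ(q)ξ = 4⟨q,ξ⟩‖q̇‖² + 4‖q‖²⟨q̇,ξ̇⟩ − 2⟨q,ξ⟩/‖q‖⁴ = 0. -/
open Real

/-- L² inner product of 1-periodic functions: `⟨f,g⟩ = ∫₀¹ f(t)g(t) dt`. -/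
noncomputable def ip (f g : ℝ → ℝ) : ℝ := ∫ t in (0:ℝ)..1, f t * g t

/-- The amplitude `c_k = 2^(-1/6) (πk)^(-1/3)`. -/
noncomputable def ck (k : ℕ) : ℝ := 2 ^ (-(1:ℝ)/6) * (Real.pi * k) ^ (-(1:ℝ)/3)

/-- The normalization of the amplitude: `(2πk)² c_k⁶ = 2`. -/
lemma frequency_sq_mul_ck_pow_six {k : ℕ} (hk : 0 < k) : (2 * π * k) ^ 2 * ck k ^ 6 = 2 := by
  have hk' : (0 : ℝ) < k := by exact_mod_cast hk
  have hpos : 0 < π * k := mul_pos pi_pos hk'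
  have h₁ : ((2 : ℝ) ^ (-(1 : ℝ) / 6)) ^ 6 = 2⁻¹ := by
    rw [← rpow_natCast, ← rpow_mul (by norm_num)]
    norm_num [rpow_neg_one]
  have h₂ : ((π * k) ^ (-(1 : ℝ) / 3)) ^ 6 = ((π * k) ^ 2)⁻¹ := by
    rw [← rpow_natCast, ← rpow_mul hpos.le, ← rpow_natCast, ← rpow_neg hpos.le]
    norm_num
  rw [ck, mul_pow (2 ^ _), h₁, h₂]
  field_simp

lemma hasDerivAt_shifted_cosine (c ω σ t : ℝ) :
    HasDerivAt (fun t => c * cos (ω * (t + σ))) (-(c * ω) * sin (ω * (t + σ))) t := by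
  have h : HasDerivAt (fun t => ω * (t + σ)) ω t := by
    simpa using ((hasDerivAt_id t).add_const σ).const_mul ω
  exact (h.cos.const_mul c).congr_deriv (by ring)

lemma hasDerivAt_shifted_sine (c ω σ t : ℝ) :
    HasDerivAt (fun t => c * sin (ω * (t + σ))) (c * ω * cos (ω * (t + σ))) t := by
  have h : HasDerivAt (fun t => ω * (t + σ)) ω t := by
    simpa using ((hasDerivAt_id t).add_const σ).const_mul ω
  exact (h.sin.const_mul c).congr_deriv (by ring)

lemma deriv_shifted_cosine (c ω σ : ℝ) :
    deriv (fun t => c * cos (ω * (t + σ))) = fun t => -(c * ω) * sin (ω * (t + σ)) :=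
  funext fun t => (hasDerivAt_shifted_cosine c ω σ t).deriv

/-- Integration by parts: the shifted cosine is a weak eigenfunction of `-d²/dt²` with
eigenvalue `(2πk)²`. -/
lemma ip_deriv_shifted_cosine (c σ : ℝ) (k : ℕ) {ξ : ℝ → ℝ} (hξ : ContDiff ℝ 1 ξ)
    (hξp : Function.Periodic ξ 1) :
    ip (deriv fun t => c * cos (2 * π * k * (t + σ))) (deriv ξ) =
      (2 * π * k) ^ 2 * ip (fun t => c * cos (2 * π * k * (t + σ))) ξ := by
  have hsin : sin (2 * π * k * (1 + σ)) = sin (2 * π * k * (0 + σ)) := by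
    rw [← sin_add_nat_mul_two_pi (2 * π * k * (0 + σ)) k]
    ring_nf
  have hξ₁ : ξ 1 = ξ 0 := by simpa using hξp 0
  have hparts := intervalIntegral.integral_mul_deriv_eq_deriv_mul (a := 0) (b := 1)
    (fun t _ => hasDerivAt_shifted_sine (-(c * (2 * π * k))) (2 * π * k) σ t)
    (fun t _ => (hξ.differentiable (by norm_num) t).hasDerivAt)
    (Continuous.intervalIntegrable (by fun_prop) _ _)
    ((hξ.continuous_deriv le_rfl).intervalIntegrable _ _)
  rw [deriv_shifted_cosine, ip, ip, hparts, hsin, hξ₁, sub_self, zero_sub,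
    ← intervalIntegral.integral_neg, ← intervalIntegral.integral_const_mul]
  congr 1 with t
  ring

lemma periodic_shifted_cosine (c σ : ℝ) (k : ℕ) :
    Function.Periodic (fun t => c * cos (2 * π * k * (t + σ))) 1 := fun t => by
  beta_reduce
  rw [← cos_add_nat_mul_two_pi (2 * π * k * (t + σ)) k]
  ring_nf

lemma ip_shifted_cosine_self (c σ : ℝ) {k : ℕ} (hk : 0 < k) :
    ip (fun t => c * cos (2 * π * k * (t + σ))) (fun t => c * cos (2 * π * k * (t + σ))) =
      c ^ 2 / 2 := by
  have hω : (2 * π * k) ^ 2 ≠ 0 := by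
    have : (k : ℝ) ≠ 0 := by exact_mod_cast hk.ne'
    positivity
  have hEnergy := ip_deriv_shifted_cosine c σ k (by fun_prop) (periodic_shifted_cosine c σ k)
  have hPythagoras : ip (deriv fun t => c * cos (2 * π * k * (t + σ)))
        (deriv fun t => c * cos (2 * π * k * (t + σ))) +
      (2 * π * k) ^ 2 * ip (fun t => c * cos (2 * π * k * (t + σ)))
        (fun t => c * cos (2 * π * k * (t + σ))) = (2 * π * k) ^ 2 * c ^ 2 := by
    rw [deriv_shifted_cosine, ip, ip, ← intervalIntegral.integral_const_mul,
      ← intervalIntegral.integral_add (Continuous.intervalIntegrable (by fun_prop) _ _)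
        (Continuous.intervalIntegrable (by fun_prop) _ _)]
    rw [intervalIntegral.integral_congr (g := fun _ => (2 * π * k) ^ 2 * c ^ 2)]
    · simp
    · intro t _
      linear_combination (2 * π * k) ^ 2 * c ^ 2 * sin_sq_add_cos_sq (2 * π * k * (t + σ))
  apply mul_left_cancel₀ hω
  linarith

/-- The shifted cosines `t ↦ c_k cos(2πk(t+σ))` are critical points of the regularized
free-fall functional `ℬ`: the first variation vanishes in every smooth periodic direction. -/
theorem shifted_cosine_is_critical (k : ℕ) (hk : 0 < k) (σ : ℝ) (q : ℝ → ℝ)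
    (hq : ∀ t, q t = ck k * Real.cos (2 * π * k * (t + σ)))
    (ξ : ℝ → ℝ) (hξ : ContDiff ℝ (⊤ : ℕ∞) ξ) (hξp : Function.Periodic ξ 1) :
    4 * ip q ξ * ip (deriv q) (deriv q) + 4 * ip q q * ip (deriv q) (deriv ξ)
      - 2 * ip q ξ / (ip q q) ^ 2 = 0 := by
  obtain rfl : q = fun t => ck k * cos (2 * π * k * (t + σ)) := funext hq
  have hc := frequency_sq_mul_ck_pow_six hk
  have hc₀ : ck k ≠ 0 := fun h => by simp [h] at hc
  rw [ip_deriv_shifted_cosine _ _ _ (hξ.of_le (by exact_mod_cast le_top)) hξp,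
    ip_deriv_shifted_cosine _ _ _ (by fun_prop) (periodic_shifted_cosine _ σ k),
    ip_shifted_cosine_self _ _ hk]
  generalize ip _ ξ = I
  field_simp
  linear_combination 4 * I * hc
end

section
/- Let q : ℝ → ℝ be smooth, 1-periodic, not identically zero, and suppose dℬ(q)ξ = 0 for every smooth 1-periodic ξ : ℝ → ℝ. Then there exist a positive integer k and σ ∈ ℝ such that q(t) = c_k·cos(2πk(t+σ)) for all t, where c_k := 2^(−1/6)·(πk)^(−1/3). -/
open Real

/-- A continuous 1-periodic function whose square integrates to zero over a period vanishes. -/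
theorem eq_zero_of_ip_self_eq_zero {f : ℝ → ℝ} (hf : Continuous f)
    (hp : Function.Periodic f 1) (h : ip f f = 0) : f = 0 := by
  have hfun : ∀ x ∈ Set.Icc (0:ℝ) 1, f x = 0 := by
    intro x hx
    by_contra hne
    have hpos : 0 < ∫ t in (0:ℝ)..1, f t * f t :=
      intervalIntegral.integral_pos one_pos (hf.mul hf).continuousOn
        (fun t _ => mul_self_nonneg (f t)) ⟨x, hx, mul_self_pos.2 hne⟩
    exact hpos.ne' h
  funext x
  obtain ⟨y, hy, hxy⟩ := hp.exists_mem_Ico₀ one_pos x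
  rw [hxy]
  exact hfun y ⟨hy.1, hy.2.le⟩

/-- Integration by parts for 1-periodic functions. -/
theorem ip_deriv_right {f g : ℝ → ℝ} (hf : ContDiff ℝ 1 f) (hg : ContDiff ℝ 1 g)
    (hfp : Function.Periodic f 1) (hgp : Function.Periodic g 1) :
    ip f (deriv g) = - ip (deriv f) g := by
  unfold ip
  rw [intervalIntegral.integral_mul_deriv_eq_deriv_mul
    (fun x _ => (hf.differentiable one_ne_zero x).hasDerivAt)
    (fun x _ => (hg.differentiable one_ne_zero x).hasDerivAt)
    ((hf.continuous_deriv le_rfl).intervalIntegrable _ _)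
    ((hg.continuous_deriv le_rfl).intervalIntegrable _ _)]
  have h1 : f 1 = f 0 := by simpa using hfp 0
  have h2 : g 1 = g 0 := by simpa using hgp 0
  rw [h1, h2]
  ring

/-- Solutions of the harmonic oscillator equation are shifted cosines. -/
theorem exists_eq_mul_cos_of_harmonic {q p : ℝ → ℝ} {ω : ℝ} (hω : ω ≠ 0)
    (hq : ∀ t, HasDerivAt q (p t) t) (hp : ∀ t, HasDerivAt p (-ω ^ 2 * q t) t) :
    ∃ R σ : ℝ, 0 ≤ R ∧ ∀ t, q t = R * Real.cos (ω * (t + σ)) := by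
  have hlin : ∀ t, HasDerivAt (fun t => ω * t) ω t := fun t => by
    simpa using (hasDerivAt_id t).const_mul ω
  have hcos := fun t => (hlin t).cos
  have hsin := fun t => (hlin t).sin
  have hu : ∀ t, HasDerivAt (fun t => q t * Real.cos (ω * t) - p t / ω * Real.sin (ω * t)) 0 t := by
    intro t
    refine (((hq t).mul (hcos t)).sub (((hp t).div_const ω).mul (hsin t))).congr_deriv ?_
    field_simp
    ring
  have hv : ∀ t, HasDerivAt (fun t => q t * Real.sin (ω * t) + p t / ω * Real.cos (ω * t)) 0 t := by
    intro t
    refine (((hq t).mul (hsin t)).add (((hp t).div_const ω).mul (hcos t))).congr_deriv ?_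
    field_simp
    ring
  have hu' := fun t => is_const_of_deriv_eq_zero (fun t => (hu t).differentiableAt)
    (fun t => (hu t).deriv) t 0
  have hv' := fun t => is_const_of_deriv_eq_zero (fun t => (hv t).differentiableAt)
    (fun t => (hv t).deriv) t 0
  simp only [mul_zero, Real.cos_zero, Real.sin_zero, mul_one, sub_zero, zero_add] at hu' hv'
  set z : ℂ := ⟨q 0, p 0 / ω⟩
  refine ⟨‖z‖, -z.arg / ω, norm_nonneg z, fun t => ?_⟩
  have hre : ‖z‖ * Real.cos z.arg = q 0 := Complex.norm_mul_cos_arg z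
  have him : ‖z‖ * Real.sin z.arg = p 0 / ω := Complex.norm_mul_sin_arg z
  have harg : ω * (t + -z.arg / ω) = ω * t - z.arg := by
    field_simp
    ring
  rw [harg, Real.cos_sub]
  linear_combination (Real.cos (ω * t)) * (hu' t) + Real.sin (ω * t) * (hv' t)
    - Real.cos (ω * t) * hre - Real.sin (ω * t) * him
    - q t * Real.sin_sq_add_cos_sq (ω * t)

/-- The amplitude `ck k` is the nonnegative sixth root of `1 / (2 π² k²)`. -/
theorem eq_ck_of_pow_six {R : ℝ} {k : ℕ} (hR : 0 ≤ R) (hk : 0 < k)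
    (h : R ^ 6 * (2 * (π * k) ^ 2) = 1) : R = ck k := by
  have hx : 0 < π * k := by positivity
  have h2 : ((2:ℝ) ^ (-(1:ℝ)/6)) ^ 6 = 2⁻¹ := by
    rw [← Real.rpow_natCast, ← Real.rpow_mul (by norm_num), ← Real.rpow_neg_one]
    norm_num
  have h3 : ((π * k) ^ (-(1:ℝ)/3)) ^ 6 = ((π * k) ^ 2)⁻¹ := by
    rw [← Real.rpow_natCast, ← Real.rpow_mul hx.le, ← Real.rpow_natCast, ← Real.rpow_neg hx.le]
    norm_num
  have hc : 0 ≤ ck k := by unfold ck; positivity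
  refine (pow_left_inj₀ hR hc (by norm_num : 6 ≠ 0)).1 ?_
  rw [ck, mul_pow, h2, h3, ← mul_inv]
  exact eq_inv_of_mul_eq_one_left h

/-- Every smooth, 1-periodic, not identically vanishing critical point of the regularized
free-fall functional `ℬ` is a shifted cosine `t ↦ c_k cos(2πk(t+σ))` for some `k ∈ ℕ`, `σ ∈ ℝ`. -/
theorem critical_point_is_shifted_cosine (q : ℝ → ℝ)
    (hqs : ContDiff ℝ (⊤ : ℕ∞) q) (hqp : Function.Periodic q 1) (hq0 : q ≠ 0)
    (hcrit : ∀ ξ : ℝ → ℝ, ContDiff ℝ (⊤ : ℕ∞) ξ → Function.Periodic ξ 1 →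
      4 * ip q ξ * ip (deriv q) (deriv q) + 4 * ip q q * ip (deriv q) (deriv ξ)
        - 2 * ip q ξ / (ip q q) ^ 2 = 0) :
    ∃ (k : ℕ) (σ : ℝ), 0 < k ∧
      ∀ t, q t = ck k * Real.cos (2 * π * k * (t + σ)) := by
  have hq1 : ContDiff ℝ (⊤ : ℕ∞) (deriv q) := (contDiff_infty_iff_deriv.1 hqs).2
  have hq2 : ContDiff ℝ (⊤ : ℕ∞) (deriv (deriv q)) := (contDiff_infty_iff_deriv.1 hq1).2
  have hone : (1 : WithTop ℕ∞) ≤ ((⊤ : ℕ∞) : WithTop ℕ∞) := by exact_mod_cast le_top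
  have hp1 : Function.Periodic (deriv q) 1 := fun x => by
    rw [← deriv_comp_add_const, show (fun x => q (x + 1)) = q from funext hqp]
  have hp2 : Function.Periodic (deriv (deriv q)) 1 := fun x => by
    rw [← deriv_comp_add_const, show (fun x => deriv q (x + 1)) = deriv q from funext hp1]
  have hd1 : ∀ t, HasDerivAt q (deriv q t) t := fun t =>
    ((hqs.of_le hone).differentiable one_ne_zero t).hasDerivAt
  have hd2 : ∀ t, HasDerivAt (deriv q) (deriv (deriv q) t) t := fun t =>
    ((hq1.of_le hone).differentiable one_ne_zero t).hasDerivAt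
  have hNpos : 0 < ip q q := by
    refine lt_of_le_of_ne ?_ fun h => hq0 (eq_zero_of_ip_self_eq_zero hqs.continuous hqp h.symm)
    exact intervalIntegral.integral_nonneg zero_le_one fun t _ => mul_self_nonneg (q t)
  have hqq := hcrit q hqs hqp
  set N := ip q q with hN
  set D := ip (deriv q) (deriv q) with hD
  have hDN : 4 * D * N ^ 2 = 1 := by
    field_simp at hqq
    linarith
  -- The Euler–Lagrange equation, obtained by testing with its own defect.
  have hode : ∀ t, deriv (deriv q) t = -(1 / (4 * N ^ 3)) * q t := by
    set η : ℝ → ℝ := fun t => (4 * D - 2 / N ^ 2) * q t - 4 * N * deriv (deriv q) t with hη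
    have hηs : ContDiff ℝ (⊤ : ℕ∞) η :=
      (contDiff_const.mul hqs).sub (contDiff_const.mul hq2)
    have hηp : Function.Periodic η 1 := fun x => by simp only [hη, hqp x, hp2 x]
    have hcη := hcrit η hηs hηp
    rw [ip_deriv_right (hq1.of_le hone) (hηs.of_le hone) hp1 hηp] at hcη
    have hsplit : ip η η = (4 * D - 2 / N ^ 2) * ip q η - 4 * N * ip (deriv (deriv q)) η := by
      unfold ip
      rw [← intervalIntegral.integral_const_mul, ← intervalIntegral.integral_const_mul,
        ← intervalIntegral.integral_sub]
      · refine intervalIntegral.integral_congr fun t _ => ?_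
        simp only [hη]
        ring
      · exact (continuous_const.mul (hqs.continuous.mul hηs.continuous)).intervalIntegrable _ _
      · exact (continuous_const.mul (hq2.continuous.mul hηs.continuous)).intervalIntegrable _ _
    have hη0 : η = 0 := by
      refine eq_zero_of_ip_self_eq_zero hηs.continuous hηp ?_
      rw [hsplit, ← hcη]
      ring
    intro t
    have ht : (4 * D - 2 / N ^ 2) * q t - 4 * N * deriv (deriv q) t = 0 := congrFun hη0 t
    have hDeq : D = 1 / (4 * N ^ 2) := by
      field_simp
      linarith
    rw [hDeq] at ht
    field_simp at ht ⊢
    linarith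
  set ω := √(1 / (4 * N ^ 3))
  have hωpos : 0 < ω := Real.sqrt_pos.2 (by positivity)
  have hω2 : ω ^ 2 = 1 / (4 * N ^ 3) := Real.sq_sqrt (by positivity)
  obtain ⟨R, σ, hR, hqR⟩ := exists_eq_mul_cos_of_harmonic hωpos.ne' hd1
    (fun t => by rw [hω2, ← hode t]; exact hd2 t)
  have hRne : R ≠ 0 := fun h => hq0 (funext fun t => by simp [hqR t, h])
  obtain ⟨n, hn⟩ : ∃ n : ℤ, (n : ℝ) * (2 * π) = ω := by
    refine (Real.cos_eq_one_iff ω).1 ?_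
    have h := hqp (-σ)
    rw [hqR, hqR] at h
    have h' := mul_left_cancel₀ hRne h
    simpa using h'
  have hnpos : 0 < n := by
    have : (0:ℝ) < n := pos_of_mul_pos_left (hn ▸ hωpos) (by positivity)
    exact_mod_cast this
  lift n to ℕ using hnpos.le with k
  have hk : 0 < k := by exact_mod_cast hnpos
  rw [Int.cast_natCast] at hn
  have hderiv : ∀ t, deriv q t = -(R * ω * Real.sin (ω * (t + σ))) := fun t => by
    have h := ((((hasDerivAt_id t).add_const σ).const_mul ω).cos).const_mul R
    rw [show q = fun t => R * Real.cos (ω * (t + σ)) from funext hqR]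
    refine (h.congr_deriv ?_).deriv
    simp only [id]
    ring
  -- Conservation of energy, integrated over a period.
  have henergy : D + ω ^ 2 * N = ω ^ 2 * R ^ 2 := by
    rw [hD, hN]
    unfold ip
    rw [← intervalIntegral.integral_const_mul, ← intervalIntegral.integral_add]
    · have : ∀ t, deriv q t * deriv q t + ω ^ 2 * (q t * q t) = ω ^ 2 * R ^ 2 := fun t => by
        rw [hderiv, hqR]
        linear_combination ω ^ 2 * R ^ 2 * Real.sin_sq_add_cos_sq (ω * (t + σ))
      simp [this]
    · exact (hq1.continuous.mul hq1.continuous).intervalIntegrable _ _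
    · exact (continuous_const.mul (hqs.continuous.mul hqs.continuous)).intervalIntegrable _ _
  have hNR : R ^ 2 = 2 * N := by
    have hω3 : ω ^ 2 * (4 * N ^ 3) = 1 := by
      rw [hω2]
      field_simp
    have hDω : D = ω ^ 2 * N := by
      have : D * (4 * N ^ 2) = (ω ^ 2 * N) * (4 * N ^ 2) := by linarith
      exact mul_right_cancel₀ (by positivity) this
    have : ω ^ 2 * R ^ 2 = ω ^ 2 * (2 * N) := by linarith
    exact mul_left_cancel₀ (by positivity) this
  have hRck : R = ck k := by
    refine eq_ck_of_pow_six hR hk ?_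
    have h6 : R ^ 6 = 8 * N ^ 3 := by
      rw [show R ^ 6 = (R ^ 2) ^ 3 by ring, hNR]
      ring
    have hπk : 4 * (π * k) ^ 2 = 1 / (4 * N ^ 3) := by
      rw [← hω2, ← hn]
      ring
    field_simp at hπk
    rw [h6]
    linarith
  refine ⟨k, σ, hk, fun t => ?_⟩
  rw [hqR t, hRck, ← hn, mul_comm (k : ℝ)]
end

section
/- For every positive integer k and every σ ∈ ℝ, the value of the regularized free-fall functional at the shifted cosine q(t) := c_k·cos(2πk(t+σ)), c_k := 2^(−1/6)·(πk)^(−1/3), is ℬ(q) = 3·2^(1/3)·(πk)^(2/3); in particular the critical value is independent of the shift σ. -/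
open Real

/-- The regularized free-fall functional `ℬ(q) = 2‖q‖²‖q̇‖² + 1/‖q‖²`. -/
noncomputable def B (q : ℝ → ℝ) : ℝ :=
  2 * ip q q * ip (deriv q) (deriv q) + 1 / ip q q

/-- The mean of `cos²` of frequency `k ≠ 0` over one period is `1/2`, whatever the shift. -/
theorem integral_cos_sq_shift {k : ℕ} (hk : k ≠ 0) (σ : ℝ) :
    ∫ t in (0:ℝ)..1, cos (2 * π * k * (t + σ)) ^ 2 = 1 / 2 := by
  have hderiv : ∀ t ∈ Set.uIcc (0:ℝ) 1, HasDerivAt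
      (fun t : ℝ => t / 2 + sin (2 * (2 * π * k * (t + σ))) / (4 * (2 * π * k)))
      (cos (2 * π * k * (t + σ)) ^ 2) t := by
    intro t _
    have hphase : HasDerivAt (fun t : ℝ => 2 * (2 * π * k * (t + σ))) (2 * (2 * π * k * 1)) t :=
      (((hasDerivAt_id t).add_const σ).const_mul _).const_mul _
    refine (((hasDerivAt_id t).div_const 2).add
      (hphase.sin.div_const (4 * (2 * π * k)))).congr_deriv ?_
    rw [cos_sq]
    field_simp
    ring
  have hper : sin (2 * (2 * π * k * (1 + σ))) = sin (2 * (2 * π * k * (0 + σ))) := by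
    rw [← sin_add_nat_mul_two_pi (2 * (2 * π * k * (0 + σ))) (2 * k)]
    push_cast
    ring_nf
  rw [intervalIntegral.integral_eq_sub_of_hasDerivAt hderiv
    (Continuous.intervalIntegrable (by fun_prop) _ _), hper]
  ring

/-- The mean of `sin²` of frequency `k ≠ 0` over one period is `1/2`, whatever the shift. -/
theorem integral_sin_sq_shift {k : ℕ} (hk : k ≠ 0) (σ : ℝ) :
    ∫ t in (0:ℝ)..1, sin (2 * π * k * (t + σ)) ^ 2 = 1 / 2 := by
  simp_rw [sin_sq]
  rw [intervalIntegral.integral_sub (by simp)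
    (Continuous.intervalIntegrable (by fun_prop) _ _), integral_cos_sq_shift hk]
  norm_num

/-- `c_k² · 2^(1/3) (πk)^(2/3) = 1`. -/
theorem ck_sq_mul {k : ℕ} (hk : k ≠ 0) :
    ck k ^ 2 * (2 ^ ((1:ℝ)/3) * (π * k) ^ ((2:ℝ)/3)) = 1 := by
  have hx : 0 < π * k := by positivity
  have h2 : ((2:ℝ) ^ (-(1:ℝ)/6)) ^ 2 * 2 ^ ((1:ℝ)/3) = 1 := by
    rw [← rpow_mul_natCast (by norm_num), ← rpow_add (by norm_num)]
    norm_num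
  have hpi : ((π * k) ^ (-(1:ℝ)/3)) ^ 2 * (π * k) ^ ((2:ℝ)/3) = 1 := by
    rw [← rpow_mul_natCast hx.le, ← rpow_add hx]
    norm_num
  rw [ck, mul_pow, mul_mul_mul_comm, h2, hpi, one_mul]

/-- The cube of `2^(1/3) (πk)^(2/3)` is `2 (πk)²`. -/
theorem two_rpow_mul_pi_rpow_cube (k : ℕ) :
    ((2:ℝ) ^ ((1:ℝ)/3) * (π * k) ^ ((2:ℝ)/3)) ^ 3 = 2 * (π * k) ^ 2 := by
  rw [mul_pow, ← rpow_mul_natCast (by norm_num), ← rpow_mul_natCast (by positivity)]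
  norm_num

/-- The critical value of `ℬ` at the shifted cosine `q(t) = c_k cos(2πk(t+σ))` is
`3·2^(1/3)(πk)^(2/3)`, independently of the shift `σ`. -/
theorem critical_value_of_shifted_cosine (k : ℕ) (hk : 0 < k) (σ : ℝ) (q : ℝ → ℝ)
    (hq : ∀ t, q t = ck k * Real.cos (2 * π * k * (t + σ))) :
    B q = 3 * 2 ^ ((1:ℝ)/3) * (π * k) ^ ((2:ℝ)/3) := by
  have hk0 : k ≠ 0 := hk.ne'
  have hdq : ∀ t, deriv q t = -(ck k * (2 * π * k)) * sin (2 * π * k * (t + σ)) := by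
    intro t
    have hphase : HasDerivAt (fun t : ℝ => 2 * π * k * (t + σ)) (2 * π * k * 1) t :=
      ((hasDerivAt_id t).add_const σ).const_mul _
    rw [funext hq, (hphase.cos.const_mul (ck k)).deriv]
    ring
  have hnorm : ip q q = ck k ^ 2 / 2 := by
    simp_rw [ip, hq, ← sq, mul_pow]
    rw [intervalIntegral.integral_const_mul, integral_cos_sq_shift hk0]
    ring
  have hnorm_deriv : ip (deriv q) (deriv q) = 2 * ck k ^ 2 * (π * k) ^ 2 := by
    simp_rw [ip, hdq, ← sq, mul_pow _ (sin _)]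
    rw [intervalIntegral.integral_const_mul, integral_sin_sq_shift hk0]
    ring
  have hck := ck_sq_mul hk0
  have hcube := two_rpow_mul_pi_rpow_cube k
  rw [B, hnorm, hnorm_deriv, mul_assoc 3]
  generalize (2:ℝ) ^ ((1:ℝ)/3) * (π * k) ^ ((2:ℝ)/3) = y at hck hcube ⊢
  have hy : y ≠ 0 := right_ne_zero_of_mul_eq_one hck
  rw [eq_inv_of_mul_eq_one_left hck]
  field_simp
  linear_combination -hcube
end

section
/- For every positive integer k and every σ ∈ ℝ, the function q(t) := c_k·cos(2πk(t+σ)) with c_k := 2^(−1/6)·(πk)^(−1/3) satisfies α_q := ‖q̇‖²/‖q‖² − 1/(2‖q‖⁶) = −(2πk)² = −2/c_k⁶; in particular q̈(t) = α_q·q(t) for all t. -/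
open Real

/-- `α_q = ‖q̇‖²/‖q‖² − 1/(2‖q‖⁶)`, with `‖q‖² = ⟨q,q⟩`. -/
noncomputable def alphaQ (q : ℝ → ℝ) : ℝ :=
  ip (deriv q) (deriv q) / ip q q - 1 / (2 * (ip q q) ^ 3)

lemma ck_pos (k : ℕ) (hk : 0 < k) : 0 < ck k := by
  unfold ck
  positivity

lemma ck_pow_six (k : ℕ) : ck k ^ 6 = 1 / (2 * (π * k) ^ 2) := by
  have hx : (0 : ℝ) ≤ π * k := by positivity
  have h2 : ((2 : ℝ) ^ (-(1 : ℝ) / 6)) ^ 6 = 2⁻¹ := by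
    rw [← rpow_natCast, ← rpow_mul (by norm_num), ← rpow_neg_one]
    norm_num
  have h3 : ((π * k) ^ (-(1 : ℝ) / 3)) ^ 6 = ((π * k) ^ 2)⁻¹ := by
    rw [← rpow_natCast, ← rpow_mul hx, ← rpow_natCast (π * k) 2, ← rpow_neg hx]
    norm_num
  rw [ck, mul_pow, h2, h3, one_div, mul_inv]

lemma integral_cos_sq_shifted (k : ℕ) (hk : 0 < k) (σ : ℝ) :
    ∫ t in (0 : ℝ)..1, cos (2 * π * k * (t + σ)) ^ 2 = 1 / 2 := by
  have hderiv (t : ℝ) : HasDerivAt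
      (fun t ↦ t / 2 + sin (2 * (2 * π * k * (t + σ))) / (4 * (2 * π * k)))
      (cos (2 * π * k * (t + σ)) ^ 2) t := by
    have h := ((((((hasDerivAt_id' t).add_const σ).const_mul (2 * π * k)).const_mul 2).sin).div_const
      (4 * (2 * π * k)))
    refine (((hasDerivAt_id' t).div_const 2).add h).congr_deriv ?_
    rw [cos_sq]
    field_simp
    ring
  rw [intervalIntegral.integral_eq_sub_of_hasDerivAt (fun t _ ↦ hderiv t)
    (Continuous.intervalIntegrable (by fun_prop) _ _)]
  have hper : sin (2 * (2 * π * k * (1 + σ))) = sin (2 * (2 * π * k * (0 + σ))) := by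
    rw [← sin_add_nat_mul_two_pi (2 * (2 * π * k * (0 + σ))) (2 * k)]
    push_cast
    ring_nf
  rw [hper]
  ring

lemma integral_sin_sq_shifted (k : ℕ) (hk : 0 < k) (σ : ℝ) :
    ∫ t in (0 : ℝ)..1, sin (2 * π * k * (t + σ)) ^ 2 = 1 / 2 := by
  simp only [sin_sq]
  rw [intervalIntegral.integral_sub (by simp)
    (Continuous.intervalIntegrable (by fun_prop) _ _), integral_cos_sq_shifted k hk]
  norm_num

lemma deriv_const_mul_cos_shifted (c ω σ : ℝ) :
    deriv (fun t ↦ c * cos (ω * (t + σ))) = fun t ↦ -(c * ω) * sin (ω * (t + σ)) := by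
  funext t
  refine HasDerivAt.deriv ?_
  refine (((((hasDerivAt_id' t).add_const σ).const_mul ω).cos).const_mul c).congr_deriv ?_
  ring

lemma deriv_const_mul_sin_shifted (c ω σ : ℝ) :
    deriv (fun t ↦ c * sin (ω * (t + σ))) = fun t ↦ c * ω * cos (ω * (t + σ)) := by
  funext t
  refine HasDerivAt.deriv ?_
  refine (((((hasDerivAt_id' t).add_const σ).const_mul ω).sin).const_mul c).congr_deriv ?_
  ring

/-- For `q(t) = c_k cos(2πk(t+σ))` one has `α_q = −(2πk)² = −2/c_k⁶`; in particular
`q̈ = α_q · q`. -/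
theorem alpha_of_shifted_cosine (k : ℕ) (hk : 0 < k) (σ : ℝ) (q : ℝ → ℝ)
    (hq : ∀ t, q t = ck k * Real.cos (2 * π * k * (t + σ))) :
    alphaQ q = -(2 * π * k) ^ 2 ∧
    alphaQ q = -2 / ck k ^ 6 ∧
    ∀ t, deriv (deriv q) t = alphaQ q * q t := by
  have hc := ck_pos k hk
  have hc6 := ck_pow_six k
  obtain rfl : q = fun t ↦ ck k * cos (2 * π * k * (t + σ)) := funext hq
  have hnorm : ip (fun t ↦ ck k * cos (2 * π * k * (t + σ)))
      (fun t ↦ ck k * cos (2 * π * k * (t + σ))) = ck k ^ 2 / 2 := by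
    simp only [ip, ← sq, mul_pow (ck k)]
    rw [intervalIntegral.integral_const_mul, integral_cos_sq_shifted k hk]
    ring
  have hnorm' : ip (fun t ↦ -(ck k * (2 * π * k)) * sin (2 * π * k * (t + σ)))
      (fun t ↦ -(ck k * (2 * π * k)) * sin (2 * π * k * (t + σ))) =
      (2 * π * k) ^ 2 * (ck k ^ 2 / 2) := by
    simp only [ip, ← sq, mul_pow (-(ck k * (2 * π * k)))]
    rw [intervalIntegral.integral_const_mul, integral_sin_sq_shifted k hk]
    ring
  have hα : alphaQ (fun t ↦ ck k * cos (2 * π * k * (t + σ))) = -(2 * π * k) ^ 2 := by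
    have hcube : 2 * (ck k ^ 2 / 2) ^ 3 = ck k ^ 6 / 4 := by ring
    rw [alphaQ, deriv_const_mul_cos_shifted, hnorm, hnorm', hcube, hc6,
      mul_div_cancel_right₀ _ (by positivity)]
    field_simp
    ring
  refine ⟨hα, ?_, fun t ↦ ?_⟩
  · rw [hα, hc6]
    field_simp
  · rw [hα, deriv_const_mul_cos_shifted, deriv_const_mul_sin_shifted]
    ring
end

section
/- Let u : ℝ × ℝ → ℝ be smooth and 1-periodic in its second variable, with u_s := u(s,·) not identically zero for every s, and suppose u solves the non-local heat equation ∂_su − ∂_t∂_tu + α_s·u = 0, where α_s := ‖∂_tu_s‖²/‖u_s‖² − 1/(2‖u_s‖⁶). Then for every natural number k the Fourier coefficients a_k(s) := 2∫₀¹ u(s,t)·cos(2πkt) dt and b_k(s) := 2∫₀¹ u(s,t)·sin(2πkt) dt satisfy the linear ODEs a_k′(s) + ((2πk)² + α_s)·a_k(s) = 0 and b_k′(s) + ((2πk)² + α_s)·b_k(s) = 0 for all s ∈ ℝ. -/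
open Real

/-- `α_s = ‖∂_t u_s‖²/‖u_s‖² − 1/(2‖u_s‖⁶)` along a path of loops `s ↦ u_s`. -/
noncomputable def alphaS (u : ℝ → ℝ → ℝ) (s : ℝ) : ℝ :=
  ip (deriv (u s)) (deriv (u s)) / ip (u s) (u s) - 1 / (2 * (ip (u s) (u s)) ^ 3)

/-- The `k`-th cosine Fourier coefficient `a_k(s) = 2∫₀¹ u(s,t) cos(2πkt) dt`. -/
noncomputable def aCoeff (u : ℝ → ℝ → ℝ) (k : ℕ) (s : ℝ) : ℝ :=
  2 * ∫ t in (0:ℝ)..1, u s t * Real.cos (2 * π * k * t)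

/-- The `k`-th sine Fourier coefficient `b_k(s) = 2∫₀¹ u(s,t) sin(2πkt) dt`. -/
noncomputable def bCoeff (u : ℝ → ℝ → ℝ) (k : ℕ) (s : ℝ) : ℝ :=
  2 * ∫ t in (0:ℝ)..1, u s t * Real.sin (2 * π * k * t)

/-- Differentiation under the integral sign for a `C¹` integrand with a continuous weight. -/
theorem hasDerivAt_integral_mul_of_contDiff {u : ℝ → ℝ → ℝ}
    (hu : ContDiff ℝ 1 (Function.uncurry u)) {φ : ℝ → ℝ} (hφ : Continuous φ) (a b s : ℝ) :
    HasDerivAt (fun r => ∫ t in a..b, u r t * φ t)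
      (∫ t in a..b, deriv (fun r => u r t) s * φ t) s := by
  have hderiv : ∀ r t, HasDerivAt (fun r => u r t)
      (fderiv ℝ (Function.uncurry u) (r, t) (1, 0)) r := fun r t =>
    (hu.differentiable one_ne_zero (r, t)).hasFDerivAt.comp_hasDerivAt
      (f := fun r => (r, t)) r ((hasDerivAt_id r).prodMk (hasDerivAt_const r t))
  have hcont : Continuous fun p : ℝ × ℝ => deriv (fun r => u r p.2) p.1 * φ p.2 := by
    have h : (fun p : ℝ × ℝ => deriv (fun r => u r p.2) p.1) =
        fun p => fderiv ℝ (Function.uncurry u) p (1, 0) := funext fun p => (hderiv p.1 p.2).deriv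
    have h' : Continuous fun p : ℝ × ℝ => deriv (fun r => u r p.2) p.1 := by
      rw [h]
      exact (hu.continuous_fderiv one_ne_zero).clm_apply continuous_const
    exact h'.mul (hφ.comp continuous_snd)
  have hcont_u : Continuous fun p : ℝ × ℝ => u p.1 p.2 := hu.continuous
  have hslice : ∀ r, Continuous fun t => u r t * φ t := fun r =>
    (hcont_u.comp (Continuous.prodMk_right r)).mul hφ
  obtain ⟨C, hC⟩ := ((isCompact_Icc (a := s - 1) (b := s + 1)).prod
    (isCompact_uIcc (a := a) (b := b))).exists_bound_of_continuousOn hcont.continuousOn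
  refine (intervalIntegral.hasDerivAt_integral_of_dominated_loc_of_deriv_le
    (F' := fun r t => deriv (fun r => u r t) r * φ t) (bound := fun _ => C)
    (Icc_mem_nhds (sub_one_lt s) (lt_add_one s))
    (.of_forall fun r => (hslice r).aestronglyMeasurable)
    ((hslice s).intervalIntegrable a b)
    (hcont.comp (Continuous.prodMk_right s)).aestronglyMeasurable
    (.of_forall fun t ht r hr => hC (r, t) ⟨hr, Set.uIoc_subset_uIcc ht⟩)
    intervalIntegrable_const
    (.of_forall fun t _ r _ => ?_)).2
  exact (hderiv r t).differentiableAt.hasDerivAt.mul_const (φ t)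

/-- Green's identity over a period: an eigenfunction `φ` of the second derivative, `φ'' = -c φ`,
with matching boundary values can be moved across the second derivative of a periodic function. -/
theorem Function.Periodic.integral_deriv_deriv_mul_eigenfunction {f φ φ' : ℝ → ℝ} {c T : ℝ}
    (hf : ContDiff ℝ 2 f) (hper : Function.Periodic f T)
    (hφ : ∀ t, HasDerivAt φ (φ' t) t) (hφ' : ∀ t, HasDerivAt φ' (-(c * φ t)) t)
    (hb : φ T = φ 0) (hb' : φ' T = φ' 0) :
    ∫ t in (0 : ℝ)..T, deriv (deriv f) t * φ t = -(c * ∫ t in (0 : ℝ)..T, f t * φ t) := by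
  have hf' : ContDiff ℝ 1 (deriv f) := hf.deriv'
  have hφc : Continuous φ := continuous_iff_continuousAt.2 fun t => (hφ t).continuousAt
  have hd : ∀ t, HasDerivAt f (deriv f t) t := fun t =>
    (hf.differentiable two_ne_zero t).hasDerivAt
  have hd' : ∀ t, HasDerivAt (deriv f) (deriv (deriv f) t) t := fun t =>
    (hf'.differentiable one_ne_zero t).hasDerivAt
  have hint : IntervalIntegrable (fun t => deriv (deriv f) t * φ t) MeasureTheory.volume 0 T :=
    ((hf'.continuous_deriv le_rfl).mul hφc).intervalIntegrable 0 T
  have hint' : IntervalIntegrable (fun t => c * (f t * φ t)) MeasureTheory.volume 0 T :=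
    ((hf.continuous.mul hφc).const_mul c).intervalIntegrable 0 T
  have hfT : f T = f 0 := hper.eq
  have hfT' : deriv f T = deriv f 0 := by
    have h := deriv_comp_add_const (f := f) T 0
    rw [show (fun x => f (x + T)) = f from funext hper, zero_add] at h
    exact h.symm
  have key : ∫ t in (0 : ℝ)..T, (deriv (deriv f) t * φ t + c * (f t * φ t)) =
      (deriv f T * φ T - f T * φ' T) - (deriv f 0 * φ 0 - f 0 * φ' 0) :=
    intervalIntegral.integral_eq_sub_of_hasDerivAt
      (f := fun t => deriv f t * φ t - f t * φ' t)
      (fun t _ => (((hd' t).mul (hφ t)).sub ((hd t).mul (hφ' t))).congr_deriv (by ring))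
      (hint.add hint')
  rw [intervalIntegral.integral_add hint hint', intervalIntegral.integral_const_mul, hfT, hfT',
    hb, hb', sub_self] at key
  linarith

/-- Pairing a periodic solution of `∂ₛu - ∂ₜ∂ₜu + α(s) u = 0` with an eigenfunction `φ'' = -c φ`
gives a solution of the linear equation `y' + (c + α(s)) y = 0`. -/
theorem deriv_integral_mul_eigenfunction_of_heat {u : ℝ → ℝ → ℝ} {α : ℝ → ℝ} {T : ℝ}
    (hu : ContDiff ℝ 2 (Function.uncurry u)) (hup : ∀ s, Function.Periodic (u s) T)
    (hheat : ∀ s t, deriv (fun r => u r t) s - deriv (deriv (u s)) t + α s * u s t = 0)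
    {φ φ' : ℝ → ℝ} {c : ℝ}
    (hφ : ∀ t, HasDerivAt φ (φ' t) t) (hφ' : ∀ t, HasDerivAt φ' (-(c * φ t)) t)
    (hb : φ T = φ 0) (hb' : φ' T = φ' 0) (s : ℝ) :
    deriv (fun r => 2 * ∫ t in (0 : ℝ)..T, u r t * φ t) s
      + (c + α s) * (2 * ∫ t in (0 : ℝ)..T, u s t * φ t) = 0 := by
  have hus : ContDiff ℝ 2 (u s) := hu.comp (contDiff_prodMk_right s)
  have hφc : Continuous φ := continuous_iff_continuousAt.2 fun t => (hφ t).continuousAt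
  have hint : IntervalIntegrable (fun t => deriv (deriv (u s)) t * φ t)
      MeasureTheory.volume 0 T :=
    ((hus.deriv'.continuous_deriv (n := 1) le_rfl).mul hφc).intervalIntegrable 0 T
  have hint' : IntervalIntegrable (fun t => α s * (u s t * φ t)) MeasureTheory.volume 0 T :=
    ((hus.continuous.mul hφc).const_mul (α s)).intervalIntegrable 0 T
  have hsplit : (fun t => deriv (fun r => u r t) s * φ t) =
      fun t => deriv (deriv (u s)) t * φ t - α s * (u s t * φ t) :=
    funext fun t => by linear_combination φ t * hheat s t
  rw [((hasDerivAt_integral_mul_of_contDiff (hu.of_le one_le_two) hφc 0 T s).const_mul 2).deriv,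
    hsplit, intervalIntegral.integral_sub hint hint', intervalIntegral.integral_const_mul,
    (hup s).integral_deriv_deriv_mul_eigenfunction hus hφ hφ' hb hb']
  ring

/-- Along a solution `u` of the non-local heat equation
`∂_s u − ∂_t∂_t u + α_s u = 0`, each Fourier coefficient satisfies the linear ODE
`a_k′(s) + ((2πk)² + α_s) a_k(s) = 0`, and similarly for `b_k`. -/
theorem fourier_coefficients_ode (u : ℝ → ℝ → ℝ)
    (hu : ContDiff ℝ (⊤ : ℕ∞) (Function.uncurry u))
    (hup : ∀ s, Function.Periodic (u s) 1)
    (hu0 : ∀ s, u s ≠ 0)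
    (hheat : ∀ s t, deriv (fun r => u r t) s - deriv (deriv (u s)) t
      + alphaS u s * u s t = 0) :
    ∀ k : ℕ, ∀ s : ℝ,
      deriv (aCoeff u k) s + ((2 * π * k) ^ 2 + alphaS u s) * aCoeff u k s = 0 ∧
      deriv (bCoeff u k) s + ((2 * π * k) ^ 2 + alphaS u s) * bCoeff u k s = 0 := by
  intro k s
  have hu2 : ContDiff ℝ 2 (Function.uncurry u) := contDiff_infty.1 hu 2
  have hlin : ∀ t : ℝ, HasDerivAt (fun t : ℝ => 2 * π * k * t) (2 * π * k) t := fun t => by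
    simpa using (hasDerivAt_id t).const_mul (2 * π * k)
  have hcos : Real.cos (2 * π * k) = 1 := by
    rw [mul_comm]; exact Real.cos_nat_mul_two_pi k
  have hsin : Real.sin (2 * π * k) = 0 := by
    rw [mul_comm, mul_left_comm, ← mul_assoc, mul_comm 2, ← Nat.cast_ofNat, ← Nat.cast_mul]
    exact Real.sin_nat_mul_pi (k * 2)
  constructor
  · exact deriv_integral_mul_eigenfunction_of_heat hu2 hup hheat
      (φ := fun t => Real.cos (2 * π * k * t))
      (φ' := fun t => -Real.sin (2 * π * k * t) * (2 * π * k))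
      (fun t => (hlin t).cos)
      (fun t => ((hlin t).sin.neg.mul_const _).congr_deriv (by ring))
      (by simp [hcos]) (by simp [hsin]) s
  · exact deriv_integral_mul_eigenfunction_of_heat hu2 hup hheat
      (φ := fun t => Real.sin (2 * π * k * t))
      (φ' := fun t => Real.cos (2 * π * k * t) * (2 * π * k))
      (fun t => (hlin t).sin)
      (fun t => ((hlin t).cos.mul_const _).congr_deriv (by ring))
      (by simp [hsin]) (by simp [hcos]) s
end

section
/- Let α : ℝ → ℝ be continuous, let k < K be natural numbers, and let a, b : ℝ → ℝ be differentiable functions satisfying a′(s) + ((2πk)² + α(s))·a(s) = 0 and b′(s) + ((2πK)² + α(s))·b(s) = 0 for all s. If a(s) → 0 as s → +∞ and b(s) → L as s → +∞ for some L ≠ 0, then a is identically zero. -/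
open Real Filter

/-- A solution of the scalar linear ODE `f' + (c + α) f = 0` is determined by its value at `s`
through the integrating factor. -/
theorem mul_exp_integral_eq_of_linear_ode {α f : ℝ → ℝ} {c : ℝ} (hα : Continuous α)
    (hf : Differentiable ℝ f) (hode : ∀ s, deriv f s + (c + α s) * f s = 0) (s t : ℝ) :
    f t * exp (c * (t - s) + ∫ x in s..t, α x) = f s := by
  have hderiv : ∀ t, HasDerivAt (fun t => f t * exp (c * (t - s) + ∫ x in s..t, α x)) 0 t := by
    intro t
    have hint : HasDerivAt (fun t => ∫ x in s..t, α x) (α t) t :=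
      (hα.integral_hasStrictDerivAt s t).hasDerivAt
    have hlin : HasDerivAt (fun t => c * (t - s)) (c * 1) t :=
      ((hasDerivAt_id t).sub_const s).const_mul c
    refine ((hf t).hasDerivAt.mul (hlin.add hint).exp).congr_deriv ?_
    simp only [Pi.add_apply]
    linear_combination exp (c * (t - s) + ∫ x in s..t, α x) * hode t
  have hconst := is_const_of_deriv_eq_zero (fun t => (hderiv t).differentiableAt)
    (fun t => (hderiv t).deriv) t s
  simpa using hconst

/-- Forward-time comparison of Fourier-mode ODEs: a solution of the lower-mode ODE
(`k < K`) that tends to `0` at `+∞` while some higher-mode solution has a nonzero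
limit at `+∞` must vanish identically. -/
theorem lower_mode_vanishes_forward (α : ℝ → ℝ) (hα : Continuous α)
    (k K : ℕ) (hkK : k < K) (a b : ℝ → ℝ)
    (ha : Differentiable ℝ a) (hb : Differentiable ℝ b)
    (haode : ∀ s, deriv a s + ((2 * π * k) ^ 2 + α s) * a s = 0)
    (hbode : ∀ s, deriv b s + ((2 * π * K) ^ 2 + α s) * b s = 0)
    (halim : Tendsto a atTop (nhds 0))
    (L : ℝ) (hL : L ≠ 0) (hblim : Tendsto b atTop (nhds L)) :
    ∀ s, a s = 0 := by
  intro s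
  have hle : (2 * π * k) ^ 2 ≤ (2 * π * K) ^ 2 := by gcongr
  have hbound : ∀ᶠ t in atTop, ‖a s * b t‖ ≤ ‖a t * b s‖ := by
    filter_upwards [eventually_ge_atTop s] with t hst
    have hcomp : a s * b t =
        a t * b s * exp (((2 * π * k) ^ 2 - (2 * π * K) ^ 2) * (t - s)) := by
      rw [← mul_exp_integral_eq_of_linear_ode hα ha haode s t,
        ← mul_exp_integral_eq_of_linear_ode hα hb hbode s t, mul_assoc (a t), mul_assoc (a t),
        mul_assoc (b t), ← exp_add, mul_comm (exp _) (b t)]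
      ring_nf
    rw [hcomp, norm_mul _ (exp _), norm_of_nonneg (exp_pos _).le]
    refine mul_le_of_le_one_right (norm_nonneg _) (exp_le_one_iff.mpr ?_)
    exact mul_nonpos_of_nonpos_of_nonneg (sub_nonpos.mpr hle) (sub_nonneg.mpr hst)
  have hzero : Tendsto (fun t => a s * b t) atTop (nhds 0) :=
    squeeze_zero_norm' hbound (by simpa using (halim.mul_const (b s)).norm)
  have hprod : a s * L = 0 := tendsto_nhds_unique (hblim.const_mul (a s)) hzero
  exact (mul_eq_zero.mp hprod).resolve_right hL
end

section
/- Let α : ℝ → ℝ be continuous, let k > K be natural numbers, and let a, b : ℝ → ℝ be differentiable functions satisfying a′(s) + ((2πk)² + α(s))·a(s) = 0 and b′(s) + ((2πK)² + α(s))·b(s) = 0 for all s. If a(s) → 0 as s → −∞ and b(s) → L as s → −∞ for some L ≠ 0, then a is identically zero. -/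
open Real Filter

/-- The integrating factor for the linear equation `f' + (c + α) f = 0`. -/
theorem mul_exp_eq_of_deriv_add_mul_eq_zero {α : ℝ → ℝ} (hα : Continuous α) {c : ℝ}
    {f : ℝ → ℝ} (hf : Differentiable ℝ f) (hode : ∀ s, deriv f s + (c + α s) * f s = 0) (s : ℝ) :
    f s * exp (c * s + ∫ t in (0 : ℝ)..s, α t) = f 0 := by
  have hderiv : ∀ x, HasDerivAt (fun x => f x * exp (c * x + ∫ t in (0 : ℝ)..x, α t)) 0 x := by
    intro x
    have hP : HasDerivAt (fun x => c * x + ∫ t in (0 : ℝ)..x, α t) (c * 1 + α x) x :=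
      ((hasDerivAt_id x).const_mul c).add (hα.integral_hasStrictDerivAt 0 x).hasDerivAt
    refine ((hf x).hasDerivAt.mul hP.exp).congr_deriv ?_
    linear_combination exp (c * x + ∫ t in (0 : ℝ)..x, α t) * hode x
  have hconst := is_const_of_deriv_eq_zero (fun x => (hderiv x).differentiableAt)
    (fun x => (hderiv x).deriv) s 0
  simpa using hconst

/-- Backward-time comparison of Fourier-mode ODEs: a solution of the higher-mode ODE
(`k > K`) that tends to `0` at `−∞` while some lower-mode solution has a nonzero
limit at `−∞` must vanish identically. -/
theorem higher_mode_vanishes_backward (α : ℝ → ℝ) (hα : Continuous α)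
    (k K : ℕ) (hkK : K < k) (a b : ℝ → ℝ)
    (ha : Differentiable ℝ a) (hb : Differentiable ℝ b)
    (haode : ∀ s, deriv a s + ((2 * π * k) ^ 2 + α s) * a s = 0)
    (hbode : ∀ s, deriv b s + ((2 * π * K) ^ 2 + α s) * b s = 0)
    (halim : Tendsto a atBot (nhds 0))
    (L : ℝ) (hL : L ≠ 0) (hblim : Tendsto b atBot (nhds L)) :
    ∀ s, a s = 0 := by
  have hA := mul_exp_eq_of_deriv_add_mul_eq_zero hα ha haode
  have hB := mul_exp_eq_of_deriv_add_mul_eq_zero hα hb hbode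
  have hgap : 0 < (2 * π * k) ^ 2 - (2 * π * K) ^ 2 := by
    have : (K : ℝ) < k := by exact_mod_cast hkK
    rw [sub_pos]
    gcongr
  have hratio : ∀ s, a s * exp (((2 * π * k) ^ 2 - (2 * π * K) ^ 2) * s) * b 0 = b s * a 0 := by
    intro s
    rw [← hA s, ← hB s, show (2 * π * k) ^ 2 * s + ∫ t in (0 : ℝ)..s, α t =
      ((2 * π * k) ^ 2 - (2 * π * K) ^ 2) * s + ((2 * π * K) ^ 2 * s + ∫ t in (0 : ℝ)..s, α t)
      by ring, exp_add (((2 * π * k) ^ 2 - (2 * π * K) ^ 2) * s)]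
    ring
  have hlim : Tendsto (fun s => b s * a 0) atBot (nhds (0 * 0 * b 0)) := by
    refine Tendsto.congr hratio ((halim.mul ?_).mul_const _)
    exact tendsto_exp_atBot.comp (tendsto_id.const_mul_atBot hgap)
  have ha0 : a 0 = 0 := by
    have := tendsto_nhds_unique hlim (hblim.mul_const (a 0))
    simpa [hL] using this
  intro s
  simpa [ha0] using hA s
end

section
/- Let u : ℝ × ℝ → ℝ be smooth, 1-periodic in its second variable, with u_s := u(s,·) not identically zero for every s, solving the non-local heat equation ∂_su − ∂_t∂_tu + α_s·u = 0, α_s := ‖∂_tu_s‖²/‖u_s‖² − 1/(2‖u_s‖⁶). Suppose there are positive integers k₊, k₋ and reals a₊, b₊, a₋, b₋ with (a₊,b₊) ≠ (0,0), (a₋,b₋) ≠ (0,0), such that for every natural number n the Fourier coefficients aₙ(s) := 2∫₀¹ u(s,t)cos(2πnt) dt and bₙ(s) := 2∫₀¹ u(s,t)sin(2πnt) dt converge as s → ±∞ to the corresponding Fourier coefficients of q₊(t) := a₊cos 2πk₊t + b₊sin 2πk₊t and q₋(t) := a₋cos 2πk₋t + b₋sin 2πk₋t respectively. Then for every natural number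 n with n < k₊ or n > k₋ one has aₙ(s) = 0 and bₙ(s) = 0 for all s ∈ ℝ. -/
open Real Filter

/-- A solution of the linear equation with coefficient `-(l + α)` is determined by its value at one point,
up to the exponential of a primitive `A` of `α`. -/
theorem mul_exp_eq_of_hasDerivAt {c α A : ℝ → ℝ} {l : ℝ} (hA : ∀ s, HasDerivAt A (α s) s)
    (hc : ∀ s, HasDerivAt c (-(l + α s) * c s) s) (r s : ℝ) :
    c s * exp (l * s + A s) = c r * exp (l * r + A r) := by
  have h : ∀ x, HasDerivAt (fun y => c y * exp (l * y + A y)) 0 x := by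
    intro x
    have hE : HasDerivAt (fun y => l * y + A y) (l + α x) x :=
      (((hasDerivAt_id x).const_mul l).add (hA x)).congr_deriv (by rw [mul_one])
    exact ((hc x).mul hE.exp).congr_deriv (by ring)
  exact is_const_of_deriv_eq_zero (fun x => (h x).differentiableAt) (fun x => (h x).deriv) s r

/-- Two solutions of linear equations with the same variable coefficient `α` are, up to an
explicit exponential factor, proportional. -/
theorem mul_eq_mul_exp_of_hasDerivAt {c d α : ℝ → ℝ} {l m : ℝ} (hα : Continuous α)
    (hc : ∀ s, HasDerivAt c (-(l + α s) * c s) s)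
    (hd : ∀ s, HasDerivAt d (-(m + α s) * d s) s) (r s : ℝ) :
    d s * c r = c s * d r * exp ((l - m) * (s - r)) := by
  have hA : ∀ s, HasDerivAt (fun s => ∫ x in (0:ℝ)..s, α x) (α s) s := fun s =>
    (hα.integral_hasStrictDerivAt 0 s).hasDerivAt
  have h1 := mul_exp_eq_of_hasDerivAt hA hc r s
  have h2 := mul_exp_eq_of_hasDerivAt hA hd r s
  simp only [exp_add] at h1 h2
  have e : exp ((l - m) * (s - r)) = exp (l * s) * exp (m * r) / (exp (l * r) * exp (m * s)) := by
    rw [← exp_add, ← exp_add, ← exp_sub]; congr 1; ring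
  have p1 := (exp_pos (l * r)).ne'
  have p2 := (exp_pos (m * s)).ne'
  have p3 := (exp_pos (∫ x in (0:ℝ)..s, α x)).ne'
  have p4 := (exp_pos (∫ x in (0:ℝ)..r, α x)).ne'
  rw [e, mul_div_assoc', eq_div_iff (mul_ne_zero p1 p2)]
  apply mul_right_cancel₀ p3
  apply mul_right_cancel₀ p4
  linear_combination c r * exp (l * r) * exp (∫ x in (0:ℝ)..r, α x) * h2
    - d r * exp (m * r) * exp (∫ x in (0:ℝ)..r, α x) * h1

/-- If `c → 0` while `d` has a nonzero limit along `F`, although their equations make `d` decay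
faster than `c` along `F`, then `c` vanishes. -/
theorem eq_zero_of_tendsto {c d α : ℝ → ℝ} {l m L : ℝ} {F : Filter ℝ} [F.NeBot]
    (hα : Continuous α)
    (hc : ∀ s, HasDerivAt c (-(l + α s) * c s) s)
    (hd : ∀ s, HasDerivAt d (-(m + α s) * d s) s)
    (hcF : Tendsto c F (nhds 0)) (hdF : Tendsto d F (nhds L)) (hL : L ≠ 0)
    (hF : Tendsto (fun s => (l - m) * s) F atBot) (r : ℝ) : c r = 0 := by
  have h1 : Tendsto (fun s => d s * c r) F (nhds (L * c r)) := hdF.mul_const _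
  have h2 : Tendsto (fun s => c s * d r * exp ((l - m) * (s - r))) F (nhds (0 * d r * 0)) := by
    refine (hcF.mul_const _).mul (tendsto_exp_atBot.comp ?_)
    simp only [mul_sub (l - m), sub_eq_add_neg _ ((l - m) * r)]
    exact tendsto_atBot_add_const_right F _ hF
  simp only [← mul_eq_mul_exp_of_hasDerivAt hα hc hd r] at h2
  have := tendsto_nhds_unique h1 h2
  simpa [hL] using this

theorem ContDiff.hasDerivAt_snd {u : ℝ → ℝ → ℝ} (hu : ContDiff ℝ (⊤ : ℕ∞) (Function.uncurry u))
    (s t : ℝ) : HasDerivAt (u s) (fderiv ℝ (Function.uncurry u) (s, t) (0, 1)) t :=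
  ((hu.differentiable (by simp)) (s, t)).hasFDerivAt.comp_hasDerivAt t
    ((hasDerivAt_const t s).prodMk (hasDerivAt_id t))

theorem ContDiff.hasDerivAt_fst {u : ℝ → ℝ → ℝ} (hu : ContDiff ℝ (⊤ : ℕ∞) (Function.uncurry u))
    (s t : ℝ) :
    HasDerivAt (fun r => u r t) (fderiv ℝ (Function.uncurry u) (s, t) (1, 0)) s :=
  ((hu.differentiable (by simp)) (s, t)).hasFDerivAt.comp_hasDerivAt (f := fun r => (r, t)) s
    ((hasDerivAt_id s).prodMk (hasDerivAt_const s t))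

theorem ContDiff.uncurry_deriv_snd {u : ℝ → ℝ → ℝ}
    (hu : ContDiff ℝ (⊤ : ℕ∞) (Function.uncurry u)) :
    ContDiff ℝ (⊤ : ℕ∞) (Function.uncurry fun s t => deriv (u s) t) := by
  have h : (Function.uncurry fun s t => deriv (u s) t)
      = fun p => fderiv ℝ (Function.uncurry u) p (0, 1) :=
    funext fun p => (hu.hasDerivAt_snd p.1 p.2).deriv
  rw [h]
  exact (hu.fderiv_right (by simp)).clm_apply contDiff_const

theorem ContDiff.uncurry_deriv_fst {u : ℝ → ℝ → ℝ}
    (hu : ContDiff ℝ (⊤ : ℕ∞) (Function.uncurry u)) :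
    ContDiff ℝ (⊤ : ℕ∞) (Function.uncurry fun s t => deriv (fun r => u r t) s) := by
  have h : (Function.uncurry fun s t => deriv (fun r => u r t) s)
      = fun p => fderiv ℝ (Function.uncurry u) p (1, 0) :=
    funext fun p => (hu.hasDerivAt_fst p.1 p.2).deriv
  rw [h]
  exact (hu.fderiv_right (by simp)).clm_apply contDiff_const

/-- The coefficient of the zeroth-order term is continuous: near each `s` it can be solved for at
a fixed point `t` with `u s t ≠ 0`. -/
theorem continuous_of_heat {u : ℝ → ℝ → ℝ} {α : ℝ → ℝ}
    (hu : ContDiff ℝ (⊤ : ℕ∞) (Function.uncurry u)) (hu0 : ∀ s, u s ≠ 0)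
    (hheat : ∀ s t, deriv (fun r => u r t) s - deriv (deriv (u s)) t + α s * u s t = 0) :
    Continuous α := by
  rw [continuous_iff_continuousAt]
  intro s
  obtain ⟨t, ht⟩ := Function.ne_iff.1 (hu0 s)
  have hi : Continuous fun r : ℝ => (r, t) := by fun_prop
  have c0 : Continuous fun r => u r t := hu.continuous.comp hi
  have c1 : Continuous fun r => deriv (fun r => u r t) r := hu.uncurry_deriv_fst.continuous.comp hi
  have c2 : Continuous fun r => deriv (deriv (u r)) t :=
    hu.uncurry_deriv_snd.uncurry_deriv_snd.continuous.comp hi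
  have h : ContinuousAt (fun r => (deriv (deriv (u r)) t - deriv (fun r => u r t) r) / u r t) s :=
    (c2.sub c1).continuousAt.div c0.continuousAt ht
  refine h.congr ?_
  filter_upwards [c0.continuousAt.eventually_ne ht] with r hr
  rw [div_eq_iff hr]
  linarith [hheat r t]

theorem hasDerivAt_integral_mul {u : ℝ → ℝ → ℝ}
    (hu : ContDiff ℝ (⊤ : ℕ∞) (Function.uncurry u)) {φ : ℝ → ℝ} (hφ : Continuous φ) (a b s : ℝ) :
    HasDerivAt (fun s => ∫ t in a..b, u s t * φ t)
      (∫ t in a..b, deriv (fun r => u r t) s * φ t) s := by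
  have hc : ∀ r, Continuous (u r) := fun r => hu.continuous.comp (by fun_prop : Continuous (r, ·))
  have hd := hu.uncurry_deriv_fst.continuous
  have hcont : Continuous fun p : ℝ × ℝ => deriv (fun r => u r p.2) p.1 * φ p.2 :=
    hd.mul (hφ.comp continuous_snd)
  obtain ⟨C, hC⟩ := ((isCompact_closedBall s 1).prod (isCompact_uIcc (a := a) (b := b)))
    |>.exists_bound_of_continuousOn hcont.continuousOn
  refine (intervalIntegral.hasDerivAt_integral_of_dominated_loc_of_deriv_le
    (F' := fun s t => deriv (fun r => u r t) s * φ t) (bound := fun _ => C)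
    (Metric.closedBall_mem_nhds s one_pos) (.of_forall fun r => ?_) ?_ ?_ ?_ ?_ ?_).2
  · exact ((hc r).mul hφ).aestronglyMeasurable
  · exact ((hc s).mul hφ).intervalIntegrable _ _
  · exact (hcont.comp (by fun_prop : Continuous (s, ·))).aestronglyMeasurable
  · exact .of_forall fun t ht x hx => hC (x, t) ⟨hx, Set.uIoc_subset_uIcc ht⟩
  · exact intervalIntegrable_const
  · exact .of_forall fun t _ x _ => (hu.hasDerivAt_fst x t).differentiableAt.hasDerivAt.mul_const _

/-- Integrating by parts twice over a period against an eigenfunction of the second derivative. -/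
theorem integral_deriv_deriv_mul_eigenfunction {v φ ψ : ℝ → ℝ} {l : ℝ}
    (hv : ContDiff ℝ 2 v) (hvp : Function.Periodic v 1)
    (hφ : ∀ t, HasDerivAt φ (ψ t) t) (hψ : ∀ t, HasDerivAt ψ (-l * φ t) t)
    (hφp : Function.Periodic φ 1) (hψp : Function.Periodic ψ 1) :
    ∫ t in (0:ℝ)..1, deriv (deriv v) t * φ t = -l * ∫ t in (0:ℝ)..1, v t * φ t := by
  have hv' : ContDiff ℝ 1 (deriv v) := hv.deriv'
  have d1 : ∀ t, HasDerivAt v (deriv v t) t := fun t =>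
    (hv.differentiable (by simp) t).hasDerivAt
  have d2 : ∀ t, HasDerivAt (deriv v) (deriv (deriv v) t) t := fun t =>
    (hv'.differentiable (by simp) t).hasDerivAt
  have c2 : Continuous (deriv (deriv v)) := hv'.continuous_deriv (by simp)
  have cφ : Continuous φ := continuous_iff_continuousAt.2 fun t => (hφ t).continuousAt
  have cψ : Continuous ψ := continuous_iff_continuousAt.2 fun t => (hψ t).continuousAt
  have hvp' : deriv v 1 = deriv v 0 := by
    have h : (fun t => v (t + 1)) = v := funext hvp
    simpa [h] using (deriv_comp_add_const v 1 0).symm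
  have e1 := intervalIntegral.integral_mul_deriv_eq_deriv_mul (a := 0) (b := 1)
    (fun t _ => hφ t) (fun t _ => d2 t) (cψ.intervalIntegrable _ _) (c2.intervalIntegrable _ _)
  have e2 := intervalIntegral.integral_mul_deriv_eq_deriv_mul (a := 0) (b := 1)
    (fun t _ => hψ t) (fun t _ => d1 t) ((cφ.const_mul (-l)).intervalIntegrable _ _)
    (hv'.continuous.intervalIntegrable _ _)
  have p1 : φ 1 = φ 0 := by simpa using hφp 0
  have p2 : ψ 1 = ψ 0 := by simpa using hψp 0
  have p3 : v 1 = v 0 := by simpa using hvp 0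
  simp only [mul_assoc, intervalIntegral.integral_const_mul] at e2
  simp only [mul_comm _ (φ _)]
  rw [e1, e2, p1, p2, p3, hvp']
  ring

theorem hasDerivAt_coeff_of_heat {u : ℝ → ℝ → ℝ} {α : ℝ → ℝ} {φ ψ : ℝ → ℝ} {l : ℝ}
    (hu : ContDiff ℝ (⊤ : ℕ∞) (Function.uncurry u)) (hup : ∀ s, Function.Periodic (u s) 1)
    (hheat : ∀ s t, deriv (fun r => u r t) s - deriv (deriv (u s)) t + α s * u s t = 0)
    (hφ : ∀ t, HasDerivAt φ (ψ t) t) (hψ : ∀ t, HasDerivAt ψ (-l * φ t) t)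
    (hφp : Function.Periodic φ 1) (hψp : Function.Periodic ψ 1) (s : ℝ) :
    HasDerivAt (fun s => 2 * ∫ t in (0:ℝ)..1, u s t * φ t)
      (-(l + α s) * (2 * ∫ t in (0:ℝ)..1, u s t * φ t)) s := by
  have cφ : Continuous φ := continuous_iff_continuousAt.2 fun t => (hφ t).continuousAt
  have hi : Continuous fun t : ℝ => (s, t) := by fun_prop
  have c0 : Continuous (u s) := hu.continuous.comp hi
  have c2 : Continuous (deriv (deriv (u s))) :=
    hu.uncurry_deriv_snd.uncurry_deriv_snd.continuous.comp hi
  have hv : ContDiff ℝ 2 (u s) :=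
    (hu.comp (contDiff_const.prodMk contDiff_id) : ContDiff ℝ (⊤ : ℕ∞) (u s)).of_le
      (WithTop.coe_le_coe.2 le_top)
  refine ((hasDerivAt_integral_mul hu cφ 0 1 s).const_mul 2).congr_deriv ?_
  have e : ∀ t, deriv (fun r => u r t) s * φ t
      = deriv (deriv (u s)) t * φ t - α s * (u s t * φ t) := fun t => by
    linear_combination φ t * hheat s t
  simp only [e]
  rw [intervalIntegral.integral_sub
    (Continuous.intervalIntegrable (by fun_prop) _ _)
    (Continuous.intervalIntegrable (by fun_prop) _ _), intervalIntegral.integral_const_mul,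
    integral_deriv_deriv_mul_eigenfunction hv (hup s) hφ hψ hφp hψp]
  ring

theorem hasDerivAt_cos_mode (k : ℕ) (t : ℝ) :
    HasDerivAt (fun t => cos (2 * π * k * t)) (-(2 * π * k) * sin (2 * π * k * t)) t :=
  ((hasDerivAt_id t).const_mul (2 * π * k)).cos.congr_deriv (by simp; ring)

theorem hasDerivAt_sin_mode (k : ℕ) (t : ℝ) :
    HasDerivAt (fun t => sin (2 * π * k * t)) (2 * π * k * cos (2 * π * k * t)) t :=
  ((hasDerivAt_id t).const_mul (2 * π * k)).sin.congr_deriv (by simp; ring)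

theorem periodic_cos_mode (k : ℕ) : Function.Periodic (fun t => cos (2 * π * k * t)) 1 :=
  fun t => by
    simp only
    rw [← cos_add_nat_mul_two_pi (2 * π * k * t) k]
    ring_nf

theorem periodic_sin_mode (k : ℕ) : Function.Periodic (fun t => sin (2 * π * k * t)) 1 :=
  fun t => by
    simp only
    rw [← sin_add_nat_mul_two_pi (2 * π * k * t) k]
    ring_nf

theorem hasDerivAt_aCoeff {u : ℝ → ℝ → ℝ} {α : ℝ → ℝ}
    (hu : ContDiff ℝ (⊤ : ℕ∞) (Function.uncurry u)) (hup : ∀ s, Function.Periodic (u s) 1)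
    (hheat : ∀ s t, deriv (fun r => u r t) s - deriv (deriv (u s)) t + α s * u s t = 0)
    (k : ℕ) (s : ℝ) :
    HasDerivAt (aCoeff u k) (-((2 * π * k) ^ 2 + α s) * aCoeff u k s) s :=
  hasDerivAt_coeff_of_heat hu hup hheat (hasDerivAt_cos_mode k)
    (fun t => ((hasDerivAt_sin_mode k t).const_mul _).congr_deriv (by ring))
    (periodic_cos_mode k) ((periodic_sin_mode k).comp (_ * ·)) s

theorem hasDerivAt_bCoeff {u : ℝ → ℝ → ℝ} {α : ℝ → ℝ}
    (hu : ContDiff ℝ (⊤ : ℕ∞) (Function.uncurry u)) (hup : ∀ s, Function.Periodic (u s) 1)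
    (hheat : ∀ s t, deriv (fun r => u r t) s - deriv (deriv (u s)) t + α s * u s t = 0)
    (k : ℕ) (s : ℝ) :
    HasDerivAt (bCoeff u k) (-((2 * π * k) ^ 2 + α s) * bCoeff u k s) s :=
  hasDerivAt_coeff_of_heat hu hup hheat (hasDerivAt_sin_mode k)
    (fun t => ((hasDerivAt_cos_mode k t).const_mul _).congr_deriv (by ring))
    (periodic_sin_mode k) ((periodic_cos_mode k).comp (_ * ·)) s

/-- If along `F` the mode `k` has a nonzero limit while mode `n` tends to zero, although the
equation makes mode `k` decay faster than mode `n` along `F`, then mode `n` vanishes. -/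
theorem coeff_eq_zero_of_tendsto {u : ℝ → ℝ → ℝ} {α : ℝ → ℝ}
    (hu : ContDiff ℝ (⊤ : ℕ∞) (Function.uncurry u)) (hup : ∀ s, Function.Periodic (u s) 1)
    (hu0 : ∀ s, u s ≠ 0)
    (hheat : ∀ s t, deriv (fun r => u r t) s - deriv (deriv (u s)) t + α s * u s t = 0)
    {F : Filter ℝ} [F.NeBot] {k n : ℕ} {a b : ℝ} (hab : (a, b) ≠ (0, 0)) (hnk : n ≠ k)
    (hA : ∀ n : ℕ, Tendsto (aCoeff u n) F (nhds (if n = k then a else 0)))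
    (hB : ∀ n : ℕ, Tendsto (bCoeff u n) F (nhds (if n = k then b else 0)))
    (hF : Tendsto (fun s => ((2 * π * n) ^ 2 - (2 * π * k) ^ 2) * s) F atBot) (s : ℝ) :
    aCoeff u n s = 0 ∧ bCoeff u n s = 0 := by
  have hα := continuous_of_heat hu hu0 hheat
  have ha := hasDerivAt_aCoeff hu hup hheat
  have hb := hasDerivAt_bCoeff hu hup hheat
  have hAn := hA n
  have hBn := hB n
  have hAk := hA k
  have hBk := hB k
  rw [if_neg hnk] at hAn hBn
  rw [if_pos rfl] at hAk hBk
  by_cases h : a = 0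
  · have hb0 : b ≠ 0 := fun hb0 => hab (by rw [h, hb0])
    exact ⟨eq_zero_of_tendsto hα (ha n) (hb k) hAn hBk hb0 hF s,
      eq_zero_of_tendsto hα (hb n) (hb k) hBn hBk hb0 hF s⟩
  · exact ⟨eq_zero_of_tendsto hα (ha n) (ha k) hAn hAk h hF s,
      eq_zero_of_tendsto hα (hb n) (ha k) hBn hAk h hF s⟩

theorem mode_sq_lt_mode_sq {m n : ℕ} (h : m < n) : (2 * π * m) ^ 2 < (2 * π * n) ^ 2 := by
  have : (m : ℝ) < n := by exact_mod_cast h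
  gcongr

/-- Isolating Fourier-mode interval: if a heat flow line converges, in the sense of
Fourier coefficients, to the pure mode-`k₊` loop `a₊cos 2πk₊t + b₊sin 2πk₊t ≠ 0` as
`s → +∞` and to the pure mode-`k₋` loop `a₋cos 2πk₋t + b₋sin 2πk₋t ≠ 0` as `s → −∞`,
then all its Fourier coefficients of modes outside `[k₊, k₋]` vanish identically. -/
theorem fourier_mode_interval (u : ℝ → ℝ → ℝ)
    (hu : ContDiff ℝ (⊤ : ℕ∞) (Function.uncurry u))
    (hup : ∀ s, Function.Periodic (u s) 1)
    (hu0 : ∀ s, u s ≠ 0)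
    (hheat : ∀ s t, deriv (fun r => u r t) s - deriv (deriv (u s)) t
      + alphaS u s * u s t = 0)
    (kp km : ℕ) (hkp : 0 < kp) (hkm : 0 < km)
    (ap bp am bm : ℝ) (hp : (ap, bp) ≠ (0, 0)) (hm : (am, bm) ≠ (0, 0))
    (hlimAp : ∀ n : ℕ, Tendsto (aCoeff u n) atTop (nhds (if n = kp then ap else 0)))
    (hlimBp : ∀ n : ℕ, Tendsto (bCoeff u n) atTop (nhds (if n = kp then bp else 0)))
    (hlimAm : ∀ n : ℕ, Tendsto (aCoeff u n) atBot (nhds (if n = km then am else 0)))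
    (hlimBm : ∀ n : ℕ, Tendsto (bCoeff u n) atBot (nhds (if n = km then bm else 0))) :
    ∀ n : ℕ, (n < kp ∨ km < n) → ∀ s : ℝ, aCoeff u n s = 0 ∧ bCoeff u n s = 0 := by
  rintro n (hn | hn)
  · exact coeff_eq_zero_of_tendsto hu hup hu0 hheat hp hn.ne hlimAp hlimBp
      (tendsto_id.const_mul_atTop_of_neg (sub_neg.2 (mode_sq_lt_mode_sq hn)))
  · exact coeff_eq_zero_of_tendsto hu hup hu0 hheat hm hn.ne' hlimAm hlimBm
      (tendsto_id.const_mul_atBot (sub_pos.2 (mode_sq_lt_mode_sq hn)))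
end

section
/- Let u be a heat flow line whose Fourier coefficients converge as s → ±∞ to those of nonzero pure-mode loops of modes k₊ (at +∞) and k₋ (at −∞), so that by the mode-interval property aₙ(s) ≡ bₙ(s) ≡ 0 for n ∉ [k₊, k₋]. Let ξ : ℝ × ℝ → ℝ be smooth, 1-periodic in t, satisfying the linearized equation D_uξ = 0, where D_uξ := ∂_sξ − ∂_t∂_tξ + α_s·ξ − (2/‖u_s‖²)·(⟨∂_t∂_tu_s, ξ_s⟩ + (α_s − 1/‖u_s‖⁶)·⟨u_s, ξ_s⟩)·u, and suppose ‖ξ_s‖ → 0 as s → +∞ and as s → −∞. Then for every natural number n with n < k₊ or n > k₋ the Fourier coefficients Aₙ(s) := 2∫₀¹ ξ(s,t)cos(2πnt) dt and Bₙ(s) := 2∫₀¹ ξ(s,t)sin(2πnt) dt vanish identically. -/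
open Real Filter

/-- The linearization `D_u` of the non-local heat operator at a heat flow line `u`:
`D_uξ = ∂_sξ − ∂_t∂_tξ + α_s ξ
  − (2/‖u_s‖²)(⟨∂_t∂_tu_s, ξ_s⟩ + (α_s − 1/‖u_s‖⁶)⟨u_s, ξ_s⟩) u`. -/
noncomputable def Du (u ξ : ℝ → ℝ → ℝ) (s t : ℝ) : ℝ :=
  deriv (fun r => ξ r t) s - deriv (deriv (ξ s)) t + alphaS u s * ξ s t
    - (2 / ip (u s) (u s))
        * (ip (deriv (deriv (u s))) (ξ s)
            + (alphaS u s - 1 / (ip (u s) (u s)) ^ 3) * ip (u s) (ξ s))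
        * u s t

open Function MeasureTheory

section PartialDerivatives

variable {v : ℝ → ℝ → ℝ}

lemma hasDerivAt_fst_of_contDiff (hv : ContDiff ℝ (⊤ : ℕ∞) (uncurry v)) (s t : ℝ) :
    HasDerivAt (fun r => v r t) (fderiv ℝ (uncurry v) (s, t) (1, 0)) s := by
  have h := (hv.differentiable (by simp) (s, t)).hasFDerivAt
  exact h.comp_hasDerivAt s ((hasDerivAt_id s).prodMk (hasDerivAt_const s t))

lemma hasDerivAt_snd_of_contDiff (hv : ContDiff ℝ (⊤ : ℕ∞) (uncurry v)) (s t : ℝ) :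
    HasDerivAt (v s) (fderiv ℝ (uncurry v) (s, t) (0, 1)) t := by
  have h := (hv.differentiable (by simp) (s, t)).hasFDerivAt
  exact h.comp_hasDerivAt t ((hasDerivAt_const t s).prodMk (hasDerivAt_id t))

lemma continuous_uncurry_deriv_fst (hv : ContDiff ℝ (⊤ : ℕ∞) (uncurry v)) :
    Continuous (uncurry fun s t => deriv (fun r => v r t) s) := by
  have : (uncurry fun s t => deriv (fun r => v r t) s) =
      fun p : ℝ × ℝ => fderiv ℝ (uncurry v) p (1, 0) := by
    ext ⟨s, t⟩
    exact (hasDerivAt_fst_of_contDiff hv s t).deriv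
  rw [this]
  exact (hv.continuous_fderiv (by simp)).clm_apply continuous_const

lemma contDiff_uncurry_deriv_snd (hv : ContDiff ℝ (⊤ : ℕ∞) (uncurry v)) :
    ContDiff ℝ (⊤ : ℕ∞) (uncurry fun s => deriv (v s)) := by
  have : (uncurry fun s => deriv (v s)) =
      fun p : ℝ × ℝ => fderiv ℝ (uncurry v) p (0, 1) := by
    ext ⟨s, t⟩
    exact (hasDerivAt_snd_of_contDiff hv s t).deriv
  rw [this]
  exact (hv.fderiv_right (by simp)).clm_apply contDiff_const

lemma contDiff_slice (hv : ContDiff ℝ (⊤ : ℕ∞) (uncurry v)) (s : ℝ) :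
    ContDiff ℝ (⊤ : ℕ∞) (v s) :=
  hv.comp (contDiff_const.prodMk contDiff_id)

lemma continuous_ip_self (hv : Continuous (uncurry v)) :
    Continuous fun s => ip (v s) (v s) := by
  unfold ip
  exact intervalIntegral.continuous_parametric_intervalIntegral_of_continuous'
    (f := fun s t => v s t * v s t) (hv.mul hv) 0 1

end PartialDerivatives

lemma ip_self_pos {f : ℝ → ℝ} (hf : Continuous f) (hp : Periodic f 1) (h0 : f ≠ 0) :
    0 < ip f f := by
  obtain ⟨x, hx⟩ := Function.ne_iff.mp h0
  obtain ⟨y, hy, hxy⟩ := hp.exists_mem_Ico₀ one_pos x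
  refine intervalIntegral.integral_pos one_pos (hf.mul hf).continuousOn
    (fun t _ => mul_self_nonneg _) ⟨y, ⟨hy.1, hy.2.le⟩, ?_⟩
  exact mul_self_pos.mpr (hxy ▸ hx)

lemma continuous_alphaS {u : ℝ → ℝ → ℝ} (hu : ContDiff ℝ (⊤ : ℕ∞) (uncurry u))
    (hpos : ∀ s, 0 < ip (u s) (u s)) : Continuous (alphaS u) := by
  have h1 := continuous_ip_self hu.continuous
  have h2 := continuous_ip_self (contDiff_uncurry_deriv_snd hu).continuous
  unfold alphaS
  exact (h2.div h1 fun s => (hpos s).ne').sub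
    (continuous_const.div (continuous_const.mul (h1.pow 3))
      fun s => (mul_pos two_pos (pow_pos (hpos s) 3)).ne')

/-- Differentiation under the integral sign for `s ↦ ⟨v_s, φ⟩`. -/
lemma hasDerivAt_ip {v : ℝ → ℝ → ℝ} (hv : ContDiff ℝ (⊤ : ℕ∞) (uncurry v)) {φ : ℝ → ℝ}
    (hφ : Continuous φ) (s : ℝ) :
    HasDerivAt (fun r => ip (v r) φ) (ip (fun t => deriv (fun r => v r t) s) φ) s := by
  have hd : Continuous (uncurry fun r t => deriv (fun r => v r t) r * φ t) :=
    (continuous_uncurry_deriv_fst hv).mul (hφ.comp continuous_snd)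
  obtain ⟨C, hC⟩ := ((isCompact_Icc (a := s - 1) (b := s + 1)).prod
    (isCompact_Icc (a := (0 : ℝ)) (b := 1))).exists_bound_of_continuousOn hd.continuousOn
  have hslice (r : ℝ) : Continuous fun t => v r t * φ t :=
    (contDiff_slice hv r).continuous.mul hφ
  refine (intervalIntegral.hasDerivAt_integral_of_dominated_loc_of_deriv_le
    (F := fun r t => v r t * φ t) (F' := fun r t => deriv (fun r => v r t) r * φ t)
    (bound := fun _ => C)
    (Icc_mem_nhds (by linarith : s - 1 < s) (by linarith : s < s + 1))
    (Eventually.of_forall fun r => (hslice r).aestronglyMeasurable)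
    ((hslice s).intervalIntegrable _ _)
    (hd.comp (Continuous.prodMk_right s)).aestronglyMeasurable
    (Eventually.of_forall fun t ht r hr => ?_) intervalIntegrable_const
    (Eventually.of_forall fun t _ r _ => ?_)).2
  · rw [Set.uIoc_of_le zero_le_one] at ht
    exact hC (r, t) ⟨hr, ht.1.le, ht.2⟩
  · exact (hasDerivAt_fst_of_contDiff hv r t).differentiableAt.hasDerivAt.mul_const _

/-- The second derivative is symmetric on periodic functions; stated for an eigenfunction `φ`
with derivative `ψ`. -/
lemma ip_deriv_deriv_eigenfunction {f φ ψ : ℝ → ℝ} {l : ℝ} (hf : ContDiff ℝ (⊤ : ℕ∞) f)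
    (hp : Periodic f 1) (hφ : ∀ t, HasDerivAt φ (ψ t) t)
    (hψ : ∀ t, HasDerivAt ψ (-l * φ t) t) (hφ1 : φ 1 = φ 0) (hψ1 : ψ 1 = ψ 0) :
    ip (deriv (deriv f)) φ = -l * ip f φ := by
  have hf' : ContDiff ℝ (⊤ : ℕ∞) (deriv f) := (contDiff_infty_iff_deriv.mp hf).2
  have hf'' : ContDiff ℝ (⊤ : ℕ∞) (deriv (deriv f)) := (contDiff_infty_iff_deriv.mp hf').2
  have hφc : Continuous φ := continuous_iff_continuousAt.mpr fun t => (hφ t).continuousAt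
  have hψc : Continuous ψ := continuous_iff_continuousAt.mpr fun t => (hψ t).continuousAt
  have hf1 : f 1 = f 0 := by simpa using hp 0
  have hf'1 : deriv f 1 = deriv f 0 := by
    have : (fun x => f (x + 1)) = f := funext hp
    rw [← zero_add (1 : ℝ), ← deriv_comp_add_const, this]
  have e1 := intervalIntegral.integral_mul_deriv_eq_deriv_mul (a := 0) (b := 1)
    (u := φ) (v := deriv f) (u' := ψ) (v' := deriv (deriv f)) (fun t _ => hφ t)
    (fun t _ => (hf'.differentiable (by simp) t).hasDerivAt)
    (hψc.intervalIntegrable _ _) (hf''.continuous.intervalIntegrable _ _)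
  have e2 := intervalIntegral.integral_mul_deriv_eq_deriv_mul (a := 0) (b := 1)
    (u := ψ) (v := f) (u' := fun t => -l * φ t) (v' := deriv f) (fun t _ => hψ t)
    (fun t _ => (hf.differentiable (by simp) t).hasDerivAt)
    ((continuous_const.mul hφc).intervalIntegrable _ _)
    (hf'.continuous.intervalIntegrable _ _)
  rw [hφ1, hf'1, sub_self, zero_sub, e2, hψ1, hf1, sub_self, zero_sub, neg_neg] at e1
  unfold ip
  rw [← intervalIntegral.integral_const_mul]
  calc _ = ∫ t in (0:ℝ)..1, φ t * deriv (deriv f) t := by simp only [mul_comm]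
    _ = _ := e1
    _ = _ := by congr 1; ext t; ring

/-- Projecting `∂_s v = ∂_t∂_t v − β v + γ w` onto an eigenfunction orthogonal to `w`. -/
lemma hasDerivAt_ip_eigenfunction {v w : ℝ → ℝ → ℝ} {β γ : ℝ → ℝ} {φ ψ : ℝ → ℝ} {l : ℝ}
    (hv : ContDiff ℝ (⊤ : ℕ∞) (uncurry v)) (hvp : ∀ s, Periodic (v s) 1)
    (hw : ∀ s, Continuous (w s))
    (heq : ∀ s t, deriv (fun r => v r t) s =
      deriv (deriv (v s)) t - β s * v s t + γ s * w s t)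
    (hφ : ∀ t, HasDerivAt φ (ψ t) t) (hψ : ∀ t, HasDerivAt ψ (-l * φ t) t)
    (hφ1 : φ 1 = φ 0) (hψ1 : ψ 1 = ψ 0) (horth : ∀ s, γ s * ip (w s) φ = 0) (s : ℝ) :
    HasDerivAt (fun r => ip (v r) φ) (-(l + β s) * ip (v s) φ) s := by
  have hφc : Continuous φ := continuous_iff_continuousAt.mpr fun t => (hφ t).continuousAt
  have hvs := contDiff_slice hv s
  have hv'' : Continuous (deriv (deriv (v s))) :=
    (contDiff_infty_iff_deriv.mp (contDiff_infty_iff_deriv.mp hvs).2).2.continuous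
  convert hasDerivAt_ip hv hφc s using 1
  have h : ip (fun t => deriv (fun r => v r t) s) φ =
      ip (deriv (deriv (v s))) φ - β s * ip (v s) φ + γ s * ip (w s) φ := by
    unfold ip
    rw [← intervalIntegral.integral_const_mul, ← intervalIntegral.integral_const_mul,
      ← intervalIntegral.integral_sub, ← intervalIntegral.integral_add]
    · congr 1; ext t; simp only [heq]; ring
    · exact ((hv''.mul hφc).sub (continuous_const.mul
        (hvs.continuous.mul hφc))).intervalIntegrable _ _
    · exact (continuous_const.mul ((hw s).mul hφc)).intervalIntegrable _ _
    · exact (hv''.mul hφc).intervalIntegrable _ _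
    · exact (continuous_const.mul (hvs.continuous.mul hφc)).intervalIntegrable _ _
  rw [h, horth, ip_deriv_deriv_eigenfunction hvs (hvp s) hφ hψ hφ1 hψ1]
  ring

lemma sq_ip_le {f φ : ℝ → ℝ} (hf : Continuous f) (hφ : Continuous φ) (h1 : ∀ t, |φ t| ≤ 1) :
    (ip f φ) ^ 2 ≤ ip f f := by
  have hfφ := hf.mul hφ
  set c := ip f φ with hc
  have hnn : 0 ≤ ∫ t in (0:ℝ)..1, (f t * f t - 2 * c * (f t * φ t) + c ^ 2) := by
    refine intervalIntegral.integral_nonneg zero_le_one fun t _ => ?_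
    have : f t ^ 2 * φ t ^ 2 ≤ f t ^ 2 :=
      mul_le_of_le_one_right (sq_nonneg _) ((sq_le_one_iff_abs_le_one _).mpr (h1 t))
    nlinarith [sq_nonneg (f t * φ t - c)]
  rw [intervalIntegral.integral_add, intervalIntegral.integral_sub,
    intervalIntegral.integral_const_mul, intervalIntegral.integral_const] at hnn
  · change 0 ≤ ip f f - 2 * c * c + (1 - 0) • c ^ 2 at hnn
    simp only [sub_zero, one_smul] at hnn
    nlinarith
  · exact (hf.mul hf).intervalIntegrable _ _
  · exact (continuous_const.mul hfφ).intervalIntegrable _ _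
  · exact ((hf.mul hf).sub (continuous_const.mul hfφ)).intervalIntegrable _ _
  · exact intervalIntegrable_const

lemma tendsto_ip_zero {v : ℝ → ℝ → ℝ} {φ : ℝ → ℝ} {F : Filter ℝ}
    (hv : ∀ s, Continuous (v s)) (hφ : Continuous φ) (h1 : ∀ t, |φ t| ≤ 1)
    (hlim : Tendsto (fun s => ip (v s) (v s)) F (nhds 0)) :
    Tendsto (fun s => ip (v s) φ) F (nhds 0) := by
  have hsq : Tendsto (fun s => √(ip (v s) (v s))) F (nhds 0) := by
    simpa using hlim.sqrt
  refine squeeze_zero_norm (fun s => ?_) hsq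
  rw [Real.norm_eq_abs]
  exact Real.abs_le_sqrt (sq_ip_le (hv s) hφ h1)

lemma eq_mul_exp_of_hasDerivAt {f β : ℝ → ℝ} {l : ℝ} (hβ : Continuous β)
    (hf : ∀ s, HasDerivAt f (-(l + β s) * f s) s) (s₀ s : ℝ) :
    f s = f s₀ * exp (-(l * (s - s₀) + ∫ r in s₀..s, β r)) := by
  have hP (r : ℝ) : HasDerivAt (fun r => l * (r - s₀) + ∫ x in s₀..r, β x) (l + β r) r := by
    have h1 := ((hasDerivAt_id r).sub_const s₀).const_mul l
    rw [mul_one] at h1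
    exact h1.add (intervalIntegral.integral_hasDerivAt_right (hβ.intervalIntegrable _ _)
      hβ.stronglyMeasurable.stronglyMeasurableAtFilter hβ.continuousAt)
  have hconst (r : ℝ) :
      HasDerivAt (fun r => f r * exp (l * (r - s₀) + ∫ x in s₀..r, β x)) 0 r := by
    exact ((hf r).mul (hP r).exp).congr_deriv (by ring)
  have h := is_const_of_deriv_eq_zero (fun r => (hconst r).differentiableAt)
    (fun r => (hconst r).deriv) s s₀
  simp only [sub_self, mul_zero, intervalIntegral.integral_same, add_zero, exp_zero,
    mul_one] at h
  rw [← h, mul_assoc, ← exp_add, add_neg_cancel, exp_zero, mul_one]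

/-- Two solutions of linear equations whose rates differ by a constant: if `g` has a nonzero
limit and `f → 0` along a filter on which `exp ((l - k) s) → 0`, then `f` vanishes. -/
lemma eq_zero_of_tendsto_s15 {f g β : ℝ → ℝ} {l k c : ℝ} {F : Filter ℝ} [F.NeBot]
    (hβ : Continuous β) (hf : ∀ s, HasDerivAt f (-(l + β s) * f s) s)
    (hg : ∀ s, HasDerivAt g (-(k + β s) * g s) s) (hfF : Tendsto f F (nhds 0))
    (hgF : Tendsto g F (nhds c)) (hc : c ≠ 0) (hF : Tendsto (fun s => (l - k) * s) F atBot)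
    (s : ℝ) : f s = 0 := by
  have key (r : ℝ) :
      f s * g r = g s * (f r * (exp ((l - k) * r) * exp (-((l - k) * s)))) := by
    rw [eq_mul_exp_of_hasDerivAt hβ hf s r, eq_mul_exp_of_hasDerivAt hβ hg s r,
      ← exp_add, mul_assoc (f s), ← exp_add]
    have : -(l * (r - s) + ∫ x in s..r, β x) + ((l - k) * r + -((l - k) * s)) =
      -(k * (r - s) + ∫ x in s..r, β x) := by ring
    rw [this]
    ring
  have h1 : Tendsto (fun r => f s * g r) F (nhds (f s * c)) := hgF.const_mul _
  have h2 : Tendsto (fun r => g s * (f r * (exp ((l - k) * r) * exp (-((l - k) * s))))) F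
      (nhds (g s * (0 * (0 * exp (-((l - k) * s)))))) :=
    (hfF.mul ((tendsto_exp_atBot.comp hF).mul_const _)).const_mul _
  have h3 := tendsto_nhds_unique h1 (h2.congr fun r => (key r).symm)
  simpa [hc] using h3

lemma hasDerivAt_cos_mul (c t : ℝ) :
    HasDerivAt (fun t => cos (c * t)) (-c * sin (c * t)) t := by
  exact ((hasDerivAt_id t).const_mul c).cos.congr_deriv (by simp only [id]; ring)

lemma hasDerivAt_sin_mul (c t : ℝ) :
    HasDerivAt (fun t => sin (c * t)) (c * cos (c * t)) t := by
  exact ((hasDerivAt_id t).const_mul c).sin.congr_deriv (by simp only [id]; ring)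

/-- `φ` is a Laplace eigenfunction on the circle of eigenvalue `l`, with derivative `ψ`,
bounded by `1`. -/
structure IsMode (φ ψ : ℝ → ℝ) (l : ℝ) : Prop where
  deriv_left : ∀ t, HasDerivAt φ (ψ t) t
  deriv_right : ∀ t, HasDerivAt ψ (-l * φ t) t
  left_one : φ 1 = φ 0
  right_one : ψ 1 = ψ 0
  abs_le : ∀ t, |φ t| ≤ 1

lemma IsMode.continuous {φ ψ : ℝ → ℝ} {l : ℝ} (h : IsMode φ ψ l) : Continuous φ :=
  continuous_iff_continuousAt.mpr fun t => (h.deriv_left t).continuousAt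

lemma cos_two_pi_mul_nat (n : ℕ) : cos (2 * π * n) = 1 := by
  rw [mul_comm]; exact cos_nat_mul_two_pi n

lemma sin_two_pi_mul_nat (n : ℕ) : sin (2 * π * n) = 0 := by
  rw [mul_comm, ← mul_assoc]; exact_mod_cast sin_nat_mul_pi (n * 2)

lemma isMode_cos (n : ℕ) : IsMode (fun t => cos (2 * π * n * t))
    (fun t => -(2 * π * n) * sin (2 * π * n * t)) ((2 * π * n) ^ 2) where
  deriv_left t := hasDerivAt_cos_mul _ t
  deriv_right t := by
    exact ((hasDerivAt_sin_mul (2 * π * n) t).const_mul (-(2 * π * n))).congr_deriv (by ring)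
  left_one := by simp [cos_two_pi_mul_nat]
  right_one := by simp [sin_two_pi_mul_nat]
  abs_le t := abs_cos_le_one _

lemma isMode_sin (n : ℕ) : IsMode (fun t => sin (2 * π * n * t))
    (fun t => 2 * π * n * cos (2 * π * n * t)) ((2 * π * n) ^ 2) where
  deriv_left t := hasDerivAt_sin_mul _ t
  deriv_right t := by
    exact ((hasDerivAt_cos_mul (2 * π * n) t).const_mul (2 * π * n)).congr_deriv (by ring)
  left_one := by simp [sin_two_pi_mul_nat]
  right_one := by simp [cos_two_pi_mul_nat]
  abs_le t := abs_sin_le_one _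

/-- A path of loops converging to a nonzero loop of mode `k` has a mode-`k` coefficient with
nonzero limit. -/
lemma exists_isMode_tendsto_ne_zero {u : ℝ → ℝ → ℝ} {k : ℕ} {a b : ℝ} {F : Filter ℝ}
    (hab : (a, b) ≠ (0, 0))
    (ha : ∀ n : ℕ, Tendsto (aCoeff u n) F (nhds (if n = k then a else 0)))
    (hb : ∀ n : ℕ, Tendsto (bCoeff u n) F (nhds (if n = k then b else 0))) :
    ∃ φ ψ c, IsMode φ ψ ((2 * π * k) ^ 2) ∧ c ≠ 0 ∧
      Tendsto (fun s => ip (u s) φ) F (nhds c) := by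
  have ha' := (ha k).const_mul (1 / 2)
  have hb' := (hb k).const_mul (1 / 2)
  simp only [if_true] at ha' hb'
  by_cases h : a = 0
  · have hb0 : b ≠ 0 := fun h' => hab (by rw [h, h'])
    refine ⟨_, _, 1 / 2 * b, isMode_sin k, by simpa using hb0, hb'.congr fun s => ?_⟩
    simp only [bCoeff, ip]; ring
  · refine ⟨_, _, 1 / 2 * a, isMode_cos k, by simpa using h, ha'.congr fun s => ?_⟩
    simp only [aCoeff, ip]; ring

/-- Elements of the kernel of the linearization `D_u` along a heat flow line `u` with
pure-mode asymptotics of modes `k₊` (at `+∞`) and `k₋` (at `−∞`) have the same isolating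
Fourier-mode interval as `u`: all their Fourier coefficients of modes outside `[k₊, k₋]`
vanish identically. -/
theorem kernel_same_mode_interval (u : ℝ → ℝ → ℝ)
    (hu : ContDiff ℝ (⊤ : ℕ∞) (Function.uncurry u))
    (hup : ∀ s, Function.Periodic (u s) 1)
    (hu0 : ∀ s, u s ≠ 0)
    (hheat : ∀ s t, deriv (fun r => u r t) s - deriv (deriv (u s)) t
      + alphaS u s * u s t = 0)
    (kp km : ℕ) (hkp : 0 < kp) (hkm : 0 < km)
    (ap bp am bm : ℝ) (hp : (ap, bp) ≠ (0, 0)) (hm : (am, bm) ≠ (0, 0))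
    (hlimAp : ∀ n : ℕ, Tendsto (aCoeff u n) atTop (nhds (if n = kp then ap else 0)))
    (hlimBp : ∀ n : ℕ, Tendsto (bCoeff u n) atTop (nhds (if n = kp then bp else 0)))
    (hlimAm : ∀ n : ℕ, Tendsto (aCoeff u n) atBot (nhds (if n = km then am else 0)))
    (hlimBm : ∀ n : ℕ, Tendsto (bCoeff u n) atBot (nhds (if n = km then bm else 0)))
    (humode : ∀ n : ℕ, (n < kp ∨ km < n) → ∀ s : ℝ,
      aCoeff u n s = 0 ∧ bCoeff u n s = 0)
    (ξ : ℝ → ℝ → ℝ)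
    (hξ : ContDiff ℝ (⊤ : ℕ∞) (Function.uncurry ξ))
    (hξp : ∀ s, Function.Periodic (ξ s) 1)
    (hker : ∀ s t, Du u ξ s t = 0)
    (hξlim : Tendsto (fun s => ip (ξ s) (ξ s)) atTop (nhds 0))
    (hξlim' : Tendsto (fun s => ip (ξ s) (ξ s)) atBot (nhds 0)) :
    ∀ n : ℕ, (n < kp ∨ km < n) → ∀ s : ℝ,
      aCoeff ξ n s = 0 ∧ bCoeff ξ n s = 0 := by
  intro n hn
  have hpos (s : ℝ) : 0 < ip (u s) (u s) :=
    ip_self_pos (contDiff_slice hu s).continuous (hup s) (hu0 s)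
  have hα := continuous_alphaS hu hpos
  have main (φ ψ : ℝ → ℝ) (hφ : IsMode φ ψ ((2 * π * n) ^ 2))
      (horth : ∀ s, ip (u s) φ = 0) (s : ℝ) : ip (ξ s) φ = 0 := by
    have hξc (s : ℝ) := (contDiff_slice hξ s).continuous
    have hf (s : ℝ) := hasDerivAt_ip_eigenfunction (v := ξ) (w := u) (β := alphaS u)
      (γ := fun s => (2 / ip (u s) (u s))
        * (ip (deriv (deriv (u s))) (ξ s)
            + (alphaS u s - 1 / (ip (u s) (u s)) ^ 3) * ip (u s) (ξ s)))
      hξ hξp (fun s => (contDiff_slice hu s).continuous)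
      (fun s t => by have := hker s t; unfold Du at this; linarith)
      hφ.deriv_left hφ.deriv_right hφ.left_one hφ.right_one
      (fun s => by rw [horth, mul_zero]) s
    have hg {k : ℕ} {η χ : ℝ → ℝ} (hη : IsMode η χ ((2 * π * k) ^ 2)) (s : ℝ) :=
      hasDerivAt_ip_eigenfunction (v := u) (w := u) (β := alphaS u) (γ := fun _ => 0)
        hu hup (fun s => (contDiff_slice hu s).continuous)
        (fun s t => by have := hheat s t; linarith)
        hη.deriv_left hη.deriv_right hη.left_one hη.right_one (fun s => zero_mul _) s
    rcases hn with hn | hn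
    · obtain ⟨η, χ, c, hη, hc, hlim⟩ := exists_isMode_tendsto_ne_zero hp hlimAp hlimBp
      refine eq_zero_of_tendsto_s15 hα hf (hg hη) (tendsto_ip_zero hξc hφ.continuous hφ.abs_le hξlim)
        hlim hc (tendsto_id.const_mul_atTop_of_neg (sub_neg.mpr ?_)) s
      have : (n : ℝ) < kp := by exact_mod_cast hn
      gcongr
    · obtain ⟨η, χ, c, hη, hc, hlim⟩ := exists_isMode_tendsto_ne_zero hm hlimAm hlimBm
      refine eq_zero_of_tendsto_s15 hα hf (hg hη) (tendsto_ip_zero hξc hφ.continuous hφ.abs_le hξlim')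
        hlim hc (tendsto_id.const_mul_atBot (sub_pos.mpr ?_)) s
      have : (km : ℝ) < n := by exact_mod_cast hn
      gcongr
  intro s
  have hA := main _ _ (isMode_cos n) fun s => by
    have := (humode n hn s).1
    simpa [aCoeff, ip] using this
  have hB := main _ _ (isMode_sin n) fun s => by
    have := (humode n hn s).2
    simpa [bCoeff, ip] using this
  exact ⟨mul_eq_zero_of_right 2 (hA s), mul_eq_zero_of_right 2 (hB s)⟩
end
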